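/- arXiv:1601.03248 — 2 statements merged into one kernel-verified Lean document; each statement's English description precedes it below -/
import Mathlib

section
/- Let G be a bridgeless cubic graph with a 2-factor consisting of two odd circuits C1 and C2, let u1u2 be an edge of G with u1 ∈ V(C1) and u2 ∈ V(C2), let M3 = E(G) \ (E(C1) ∪ E(C2)), let M2 be the perfect matching of G with M2 ∩ M3 = {u1u2}, and let M1 = (E(C1) ∪ E(C2)) \ M2. For i = 1, 2, let C_{i+2} be the circuit containing u_i in the subgraph of G induced by E(G) \ M2. Suppose C3 ≠ C4, E(C3) ∩ E(C2) = ∅, and E(C1) ∩ E(C4) = ∅. Let C5 be a circuit in the subgraph of G induced by E(G) \ M2 with E(C5) ∩ E(C1) ≠ ∅ and E(C5) ∩ E(C2) ≠ ∅, and let Q be the inclusionwise maximal path containing u1 in C1 with E(Q) ∩ E(C5) = ∅. Suppose G has two circuits C and C′ such that: (1) u1 ∈ V(C) ∩ V(C′); (2) ∅ ≠ E(C) ∩ E(C2) ⊆ E(C5) ∩ E(C2), E(C′) ∩ E(C2) ⊆ E(C5) ∩ E(C2), and E(C) ∩ E(C′) ∩ E(C2) = ∅; (3) the paths Q1, Q2,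 …, Qq into which the edges of E(C) ∩ E(C2) separate C satisfy that E(Q) ⊆ E(Q1) and, for each i ∈ {2,…,q}, M2 ∩ E(Q_i) is a perfect matching of Q_i − (V(Q_i) ∩ V(C2)); (4) the subgraph of G induced by V(C1), with the vertices of V(C) ∩ V(C1) removed, has two perfect matchings N2 and N3 satisfying E(C1) \ (E(C) ∪ N2 ∪ N3) ⊆ (M1 ∩ E(C1)) \ E(C′); and (5) (M1 ∩ E(C1)) \ E(C′) is a perfect matching of C1 − (V(C′) ∩ V(C1)) and E(C′) \ M1 is a perfect matching of C′ − u1. Then G has 5 perfect matchings which together cover all edges of G. -/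
/-- A multigraph on vertex type `V` with edge type `E`: each edge is assigned an
unordered pair of distinct endpoints (multiple edges allowed, loops forbidden). -/
structure Multigraph (V : Type*) (E : Type*) where
  inc : E → Sym2 V
  no_loops : ∀ e : E, ¬ (inc e).IsDiag

namespace Multigraph

variable {V E : Type*} (G : Multigraph V E)

/-- The set of vertices incident with some edge in the edge set `F`. -/
def supp (F : Set E) : Set V := {v | ∃ e ∈ F, v ∈ G.inc e}

/-- The degree of a vertex `v` in the subgraph given by the edge set `F`. -/
noncomputable def deg (F : Set E) (v : V) : ℕ := {e ∈ F | v ∈ G.inc e}.ncard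

/-- `G` is cubic, i.e. 3-regular. -/
def IsCubic : Prop := ∀ v : V, G.deg Set.univ v = 3

/-- Adjacency via an edge of the edge set `F`. -/
def Adj (F : Set E) (u v : V) : Prop := ∃ e ∈ F, G.inc e = s(u, v)

/-- `u` and `v` are joined by a walk using only edges of `F`. -/
def Reach (F : Set E) : V → V → Prop := Relation.ReflTransGen (G.Adj F)

/-- `G` is bridgeless: no edge is a cut edge, i.e. the ends of every edge are
joined by a walk avoiding that edge. -/
def Bridgeless : Prop :=
  ∀ e : E, ∀ u v : V, G.inc e = s(u, v) → G.Reach (Set.univ \ {e}) u v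

/-- `M` is a perfect matching of the subgraph of `G` with vertex set `S` whose
edges are the edges of `F` having both ends in `S`: the edges of `M` lie in `F`,
have both ends in `S`, and every vertex of `S` lies on exactly one edge of `M`. -/
def IsPMOn (S : Set V) (F : Set E) (M : Set E) : Prop :=
  M ⊆ F ∧ (∀ e ∈ M, ∀ v ∈ G.inc e, v ∈ S) ∧ ∀ v ∈ S, ∃! e, e ∈ M ∧ v ∈ G.inc e

/-- `M` is a perfect matching of `G`. -/
def IsPM (M : Set E) : Prop := G.IsPMOn Set.univ Set.univ M

/-- The edge set `C` is a circuit of `G`: nonempty, 2-regular, and connected. -/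
def IsCircuit (C : Set E) : Prop :=
  C.Nonempty ∧ (∀ v ∈ G.supp C, G.deg C v = 2) ∧
    ∀ u ∈ G.supp C, ∀ v ∈ G.supp C, G.Reach C u v

end Multigraph

/-- Oriented edges of a matching: `rev` exchanges the two orientations of an edge, and `key` is
the underlying edge. -/
structure DartSystem (D K : Type*) where
  rev : D → D
  key : D → K
  rev_rev : ∀ d, rev (rev d) = d
  rev_ne : ∀ d, rev d ≠ d
  key_eq : ∀ a b, key a = key b ↔ b = a ∨ b = rev a

namespace DartSystem

variable {D K : Type*} (Δ : DartSystem D K)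

/-- A list of darts with pairwise distinct underlying edges, consecutive ones being related. -/
structure IsPath (S : D → D → Prop) (l : List D) : Prop where
  chain : l.IsChain S
  pairwise : l.Pairwise (fun a b => Δ.key a ≠ Δ.key b)

/-- The relation is invariant under reversing the direction of travel. -/
def Reversible (S : D → D → Prop) : Prop := ∀ a b, S a b → S (Δ.rev b) (Δ.rev a)

/-- The list traversed backwards. -/
def revList (l : List D) : List D := (l.map Δ.rev).reverse

/-- No underlying edge is common to both lists. -/
def Off (l l' : List D) : Prop := ∀ a ∈ l, ∀ b ∈ l', Δ.key a ≠ Δ.key b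

variable {Δ} {S : D → D → Prop}

theorem key_rev (d : D) : Δ.key (Δ.rev d) = Δ.key d :=
  ((Δ.key_eq _ _).2 (Or.inr rfl)).symm

theorem rev_inj {a b : D} : Δ.rev a = Δ.rev b ↔ a = b :=
  ⟨fun h => by rw [← Δ.rev_rev a, h, Δ.rev_rev], fun h => by rw [h]⟩

@[simp] theorem mem_revList {l : List D} {d : D} : d ∈ Δ.revList l ↔ Δ.rev d ∈ l := by
  simp only [revList, List.mem_reverse, List.mem_map]
  constructor
  · rintro ⟨a, ha, rfl⟩; rwa [Δ.rev_rev]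
  · exact fun h => ⟨_, h, Δ.rev_rev d⟩

@[simp] theorem revList_nil : Δ.revList [] = [] := rfl

@[simp] theorem revList_append (l l' : List D) :
    Δ.revList (l ++ l') = Δ.revList l' ++ Δ.revList l := by
  simp [revList]

@[simp] theorem revList_cons (d : D) (l : List D) :
    Δ.revList (d :: l) = Δ.revList l ++ [Δ.rev d] := by
  simp [revList]

@[simp] theorem revList_revList (l : List D) : Δ.revList (Δ.revList l) = l := by
  simp [revList, Function.comp_def, Δ.rev_rev]

@[simp] theorem head?_revList (l : List D) : (Δ.revList l).head? = l.getLast?.map Δ.rev := by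
  simp [revList]

@[simp] theorem getLast?_revList (l : List D) : (Δ.revList l).getLast? = l.head?.map Δ.rev := by
  simp [revList]

theorem Off.symm {l l' : List D} (h : Δ.Off l l') : Δ.Off l' l :=
  fun a ha b hb => (h b hb a ha).symm

theorem Off.mono {l l' m m' : List D} (h : Δ.Off l l') (h1 : ∀ a ∈ m, a ∈ l)
    (h2 : ∀ a ∈ m', a ∈ l') : Δ.Off m m' :=
  fun a ha b hb => h a (h1 a ha) b (h2 b hb)

theorem off_append_left {l m l' : List D} : Δ.Off (l ++ m) l' ↔ Δ.Off l l' ∧ Δ.Off m l' := by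
  simp only [Off, List.mem_append]; grind

theorem off_append_right {l l' m : List D} : Δ.Off l (l' ++ m) ↔ Δ.Off l l' ∧ Δ.Off l m := by
  simp only [Off, List.mem_append]; grind

theorem off_revList_left {l l' : List D} : Δ.Off (Δ.revList l) l' ↔ Δ.Off l l' := by
  constructor
  · intro h a ha b hb
    rw [← key_rev a]
    exact h _ (by simpa [Δ.rev_rev] using ha) b hb
  · intro h a ha b hb
    rw [← key_rev a]
    exact h _ (by simpa using ha) b hb

theorem off_revList_right {l l' : List D} : Δ.Off l (Δ.revList l') ↔ Δ.Off l l' :=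
  ⟨fun h => (off_revList_left.1 h.symm).symm, fun h => (off_revList_left.2 h.symm).symm⟩

namespace IsPath

variable {l l' : List D}

theorem left (h : Δ.IsPath S (l ++ l')) : Δ.IsPath S l :=
  ⟨(List.isChain_append.1 h.chain).1, (List.pairwise_append.1 h.pairwise).1⟩

theorem right (h : Δ.IsPath S (l ++ l')) : Δ.IsPath S l' :=
  ⟨(List.isChain_append.1 h.chain).2.1, (List.pairwise_append.1 h.pairwise).2.1⟩

theorem off (h : Δ.IsPath S (l ++ l')) : Δ.Off l l' :=
  (List.pairwise_append.1 h.pairwise).2.2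

theorem mono {T : D → D → Prop} (h : Δ.IsPath S l) (hST : ∀ a b, S a b → T a b) :
    Δ.IsPath T l :=
  ⟨h.chain.imp (fun _ _ => hST _ _), h.pairwise⟩

theorem append (h : Δ.IsPath S l) (h' : Δ.IsPath S l') (ho : Δ.Off l l')
    (hS : ∀ x ∈ l.getLast?, ∀ y ∈ l'.head?, S x y) : Δ.IsPath S (l ++ l') :=
  ⟨List.isChain_append.2 ⟨h.chain, h'.chain, hS⟩,
    List.pairwise_append.2 ⟨h.pairwise, h'.pairwise, ho⟩⟩

theorem revList (h : Δ.IsPath S l) (hS : Δ.Reversible S) : Δ.IsPath S (Δ.revList l) := by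
  constructor
  · rw [DartSystem.revList, List.isChain_reverse, List.isChain_map]
    exact h.chain.imp (fun a b hab => hS a b hab)
  · rw [DartSystem.revList, List.pairwise_reverse, List.pairwise_map]
    refine h.pairwise.imp (fun {a b} hab => ?_)
    rw [key_rev, key_rev]
    exact hab.symm

/-- Follow one path up to a dart and then another one from this dart on. -/
theorem splice {A B C E : List D} {y : D} (h : Δ.IsPath S (A ++ y :: B))
    (h' : Δ.IsPath S (C ++ y :: E)) (ho : Δ.Off A E) : Δ.IsPath S (A ++ y :: E) := by
  have h1 := List.isChain_append.1 h.chain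
  have h2 := List.isChain_append.1 h'.chain
  refine ⟨List.isChain_append.2 ⟨h1.1, h2.2.1, by simpa using h1.2.2⟩, ?_⟩
  have h3 := List.pairwise_append.1 h.pairwise
  have h4 := List.pairwise_append.1 h'.pairwise
  refine List.pairwise_append.2 ⟨h3.1, h4.2.1, fun a ha b hb => ?_⟩
  rcases List.mem_cons.1 hb with rfl | hb
  · exact h3.2.2 a ha _ (by simp)
  · exact ho a ha b hb

theorem rev_not_mem (h : Δ.IsPath S l) {d : D} (hd : d ∈ l) : Δ.rev d ∉ l := by
  intro hd'
  obtain ⟨A, B, rfl⟩ := List.append_of_mem hd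
  have h3 := List.pairwise_append.1 h.pairwise
  have h4 := List.pairwise_cons.1 h3.2.1
  simp only [List.mem_append, List.mem_cons] at hd'
  rcases hd' with h5 | h5 | h5
  · exact h3.2.2 _ h5 d (by simp) (key_rev d)
  · exact Δ.rev_ne d h5
  · exact h4.1 _ h5 (key_rev d).symm

theorem eq_of_key {a b : D} (h : Δ.IsPath S l) (ha : a ∈ l) (hb : b ∈ l)
    (hk : Δ.key a = Δ.key b) : a = b := by
  rcases (Δ.key_eq a b).1 hk with h1 | h1
  · exact h1.symm
  · exact absurd (h1 ▸ hb) (h.rev_not_mem ha)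

theorem nodup (h : Δ.IsPath S l) : l.Nodup :=
  h.pairwise.imp (fun hab he => hab (by rw [he]))

theorem append_cons_inj {A B P Q : List D} {y : D} (h : Δ.IsPath S (A ++ y :: B))
    (he : P ++ y :: Q = A ++ y :: B) : P = A ∧ Q = B := by
  have hn := List.nodup_middle.1 h.nodup
  have hn' := List.nodup_middle.1 (he ▸ h.nodup)
  simp only [List.nodup_cons, List.mem_append, not_or] at hn hn'
  have := (List.append_cons_inj_of_notMem hn'.1.1 hn'.1.2).1 he
  exact ⟨this.1, this.2.2⟩

end IsPath

variable (Δ) in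
/-- The list passes from `a` to `b`, or backwards from the reverse of `b` to the reverse
of `a`. -/
def Traverses (l : List D) (a b : D) : Prop := [a, b] <:+: l ∨ [Δ.rev b, Δ.rev a] <:+: l

namespace IsPath

theorem mem_of_traverses_pred {A B : List D} {w y : D} (h : Δ.IsPath S (A ++ y :: B))
    (hi : Δ.Traverses (A ++ y :: B) w y) : w ∈ A := by
  rcases hi with ⟨P, Q, hPQ⟩ | hi
  · have h1 : (P ++ [w]) ++ y :: Q = A ++ y :: B := by simpa using hPQ
    rw [← (h.append_cons_inj h1).1]
    simp
  · exact absurd (hi.subset (by simp)) (h.rev_not_mem (d := y) (by simp))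

theorem mem_of_traverses_succ {A B : List D} {w y : D} (h : Δ.IsPath S (A ++ y :: B))
    (hi : Δ.Traverses (A ++ y :: B) y w) : w ∈ B := by
  rcases hi with ⟨P, Q, hPQ⟩ | hi
  · have h1 : P ++ y :: (w :: Q) = A ++ y :: B := by simpa using hPQ
    rw [← (h.append_cons_inj h1).2]
    simp
  · exact absurd (hi.subset (by simp)) (h.rev_not_mem (d := y) (by simp))

end IsPath

variable (Δ) in
/-- A path with prescribed first and last dart. -/
structure Joins (S : D → D → Prop) (p r : D) (l : List D) : Prop where
  path : Δ.IsPath S l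
  head : l.head? = some p
  last : l.getLast? = some r

namespace Joins

variable {p q r s : D} {l : List D}

theorem revList (h : Δ.Joins S p r l) (hS : Δ.Reversible S) :
    Δ.Joins S (Δ.rev r) (Δ.rev p) (Δ.revList l) :=
  ⟨h.path.revList hS, by simp [h.last], by simp [h.head]⟩

theorem splice {A B C E : List D} {y : D} (h : Δ.Joins S p q (A ++ y :: B))
    (h' : Δ.Joins S s r (C ++ y :: E)) (ho : Δ.Off A E) : Δ.Joins S p r (A ++ y :: E) := by
  refine ⟨h.path.splice h'.path ho, ?_, ?_⟩
  · rw [← h.head]; cases A <;> simp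
  · rw [← h'.last]; simp [List.getLast?_append, List.getLast?_cons]

theorem append {l' : List D} (h : Δ.Joins S p r l) (h' : Δ.Joins S q s l') (ho : Δ.Off l l')
    (hrq : S r q) : Δ.Joins S p s (l ++ l') := by
  refine ⟨h.path.append h'.path ho ?_, ?_, ?_⟩
  · simpa [h.last, h'.head] using hrq
  · rw [List.head?_append, h.head]; rfl
  · rw [List.getLast?_append, h'.last]; rfl

theorem mem_head (h : Δ.Joins S p r l) : p ∈ l := List.mem_of_head? h.head

theorem mem_last (h : Δ.Joins S p r l) : r ∈ l := List.mem_of_getLast? h.last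

theorem mono {T : D → D → Prop} (h : Δ.Joins S p r l) (hST : ∀ a b, S a b → T a b) :
    Δ.Joins T p r l := ⟨h.path.mono hST, h.head, h.last⟩

end Joins

theorem exists_first {α : Type*} {P : α → Prop} {l : List α} (h : ∃ x ∈ l, P x) :
    ∃ e y f, l = e ++ y :: f ∧ P y ∧ ∀ x ∈ e, ¬ P x := by
  induction l with
  | nil => simp at h
  | cons a l ih =>
    by_cases ha : P a
    · exact ⟨[], a, l, rfl, ha, by simp⟩
    · obtain ⟨e, y, f, rfl, hy, he⟩ := ih (by grind)
      exact ⟨a :: e, y, f, rfl, hy, by grind⟩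

theorem exists_last {α : Type*} {P : α → Prop} {l : List α} (h : ∃ x ∈ l, P x) :
    ∃ e y f, l = e ++ y :: f ∧ P y ∧ ∀ x ∈ f, ¬ P x := by
  obtain ⟨e, y, f, h1, hy, he⟩ := exists_first (l := l.reverse) (P := P) (by simpa using h)
  refine ⟨f.reverse, y, e.reverse, ?_, hy, by simpa using he⟩
  rw [← List.reverse_reverse l, h1]; simp

theorem exists_cons_of_append_eq {α : Type*} {A B C E : List α} {b : α}
    (h : A ++ B = C ++ b :: E) (hb : b ∉ A) : ∃ C', C = A ++ C' := by
  rcases List.append_eq_append_iff.1 h with ⟨a, h1, h2⟩ | ⟨a, h1, h2⟩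
  · exact ⟨a, h1⟩
  · cases a with
    | nil => exact ⟨[], by simpa using h1.symm⟩
    | cons x a => simp at h2; grind

theorem exists_append_cons_of_append_eq {α : Type*} {A B C E : List α} {b : α}
    (h : A ++ b :: B = C ++ E) (hb : b ∉ E) : ∃ C', C = A ++ b :: C' := by
  rcases List.append_eq_append_iff.1 h with ⟨a, h1, h2⟩ | ⟨a, h1, h2⟩
  · cases a with
    | nil => simp at h2; simp [← h2] at hb
    | cons x a => simp at h2; exact ⟨a, by rw [h1, h2.1]⟩
  · simp [h2] at hb

variable (Δ) in
/-- Every step of `T` is used by any two paths of `T` of which one meets `N` and the other one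
avoids it. -/
def IsMinimalFor (T : D → D → Prop) (N : Set K) (p r : D) : Prop :=
  ∀ l c, Δ.Joins T p r l → (∃ x ∈ l, Δ.key x ∈ N) → Δ.Joins T p r c →
    (∀ x ∈ c, Δ.key x ∉ N) → ∀ a b, T a b → Δ.Traverses l a b ∨ Δ.Traverses c a b

variable (Δ) in
/-- A path avoiding `N` can be rerouted so that it leaves free a segment of `l` from `h` on, or
there is an additional path to `h` which leaves free the end of `l` from `b` on. -/
def Detour (T : D → D → Prop) (N : Set K) (p r : D) (l : List D) (h b : D) (Z : List D) : Prop :=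
  ∃ c, Δ.Joins T p r c ∧ (∀ x ∈ c, Δ.key x ∉ N) ∧
    ((∃ X Y, l = X ++ h :: (Y ++ b :: Z) ∧ Δ.Off c (h :: Y)) ∨
      ∃ α, Δ.Joins T p (Δ.rev h) α ∧ Δ.Off α (b :: Z) ∧
        ∀ x ∈ α, ∃ y ∈ c ++ l, Δ.key x = Δ.key y)

theorem detour_of_append {T : D → D → Prop} {N : Set K} {p r : D} (hT : Δ.Reversible T)
    (hmin : Δ.IsMinimalFor T N p r) {l : List D} (hl : Δ.Joins T p r l) {h b : D} {Z : List D}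
    (hh : Δ.key h ∈ N) (hb : Δ.key b ∈ N) (hZ : ∀ x ∈ Z, Δ.key x ∉ N) :
    ∀ (n : ℕ) (X Y c' c'' : List D), Y.length ≤ n → l = X ++ (Y ++ b :: Z) → h ∈ Y → X ≠ [] →
      c' ≠ [] → Δ.Joins T p r (c' ++ c'') → (∀ x ∈ c' ++ c'', Δ.key x ∉ N) →
      Δ.Off c' (Y ++ b :: Z) → Δ.Off c'' X → Δ.Detour T N p r l h b Z := by
  intro n
  induction n with
  | zero => 
    intro X Y c' c'' hn _ hY
    simp_all
  | succ n ih =>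
    intro X Y c' c'' hn hlX hhY hX hc' hc hcN ho' ho''
    have hlp := hl.path
    rw [hlX] at hlp
    have hbY : b ∉ Y := fun hbY => hlp.right.off b hbY b (by simp) rfl
    -- the last dart
    have hlast : r ∈ Y ++ b :: Z := by
      have := hl.last
      rw [hlX, List.getLast?_append_of_ne_nil _ (by simp)] at this
      exact List.mem_of_getLast? this
    have hrc : r ∈ c'' := (List.mem_append.1 hc.mem_last).resolve_left
      fun h1 => ho' r h1 r hlast rfl
    obtain ⟨e, y, f, rfl, ⟨v, hvW, hyv⟩, he⟩ := exists_first
      (P := fun x => ∃ v ∈ Y ++ b :: Z, Δ.key x = Δ.key v) ⟨r, hrc, r, hlast, rfl⟩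
    have hce : Δ.Off (c' ++ e) (Y ++ b :: Z) :=
      off_append_left.2 ⟨ho', fun x hx v hv hxv => he x hx ⟨v, hv, hxv⟩⟩
    have hcp := hc.path
    rw [← List.append_assoc] at hcp
    have hyc : y ∈ c' ++ (e ++ y :: f) := by simp
    have hyN : Δ.key y ∉ N := hcN y hyc
    have hyb : y ≠ b := fun h1 => hyN (h1 ▸ hb)
    rcases (Δ.key_eq _ _).1 hyv with rfl | rfl
    · rcases List.mem_append.1 hvW with hyY | hyZ
      · obtain ⟨Y1, Y2, rfl⟩ := List.append_of_mem hyY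
        have hlp' : Δ.IsPath T ((X ++ Y1) ++ v :: (Y2 ++ b :: Z)) := by simpa using hlp
        have hΛ : Δ.Joins T p r ((c' ++ e) ++ v :: (Y2 ++ b :: Z)) :=
          Joins.splice (B := f) (C := X ++ Y1) (by simpa using hc) (by simpa [hlX] using hl)
            (hce.mono (fun _ h1 => h1) (by clear ih; grind))
        rcases List.eq_nil_or_concat Y1 with rfl | ⟨W, w, rfl⟩
        · refine ih (X ++ [v]) Y2 (c' ++ e ++ [v]) f (by simp at hn ⊢; omega) (by simp [hlX])
            (by clear ih; grind) (by simp) (by simp) (by simpa using hc) (by simpa using hcN) ?_ ?_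
          · refine off_append_left.2 ⟨hce.mono (fun _ h1 => h1) (by simp +contextual), ?_⟩
            have h1 : Δ.IsPath T ((X ++ [v]) ++ (Y2 ++ b :: Z)) := by simpa using hlp
            exact h1.off.mono (by simp) (fun _ h1 => h1)
          · refine off_append_right.2 ⟨ho''.mono (by simp +contextual) (fun _ h1 => h1), ?_⟩
            have h1 : Δ.IsPath T ((c' ++ e ++ [v]) ++ f) := by simpa using hcp
            exact h1.off.symm.mono (fun _ h1 => h1) (by simp)
        · exfalso
          have hstep : T w v := by
            have h1 : (X ++ W ++ [w]) ++ v :: (Y2 ++ b :: Z) = l := by simp [hlX]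
            exact (List.isChain_append.1 (h1 ▸ hl.path.chain)).2.2 w (by simp) v (by simp)
          have hw : w ∈ c' ++ e := by
            rcases hmin _ _ hΛ ⟨b, by simp, hb⟩ hc hcN w v hstep with h1 | h1
            · exact hΛ.path.mem_of_traverses_pred h1
            · rw [← List.append_assoc] at h1
              exact hcp.mem_of_traverses_pred h1
          exact hce w hw w (by simp) rfl
      · obtain ⟨Z1, Z2, rfl⟩ := List.append_of_mem
          ((List.mem_cons.1 hyZ).resolve_left hyb)
        have hlp' : Δ.IsPath T ((X ++ (Y ++ b :: Z1)) ++ v :: Z2) := by simpa using hlp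
        have hΛ : Δ.Joins T p r ((c' ++ e) ++ v :: Z2) :=
          Joins.splice (B := f) (C := X ++ (Y ++ b :: Z1)) (by simpa using hc)
            (by simpa [hlX] using hl) (hce.mono (fun _ h1 => h1) (by clear ih; grind))
        obtain ⟨Y0, Y1, rfl⟩ := List.append_of_mem hhY
        refine ⟨_, hΛ, by clear ih; grind, Or.inl ⟨X ++ Y0, Y1, by simp [hlX], ?_⟩⟩
        refine off_append_left.2 ⟨hce.mono (fun _ h1 => h1) (by clear ih; grind), ?_⟩
        exact hlp'.off.symm.mono (fun _ h1 => h1) (by clear ih; grind)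
    · have key2 : ∀ W1 W2, Y ++ b :: Z = W1 ++ Δ.rev y :: W2 →
          ((∃ Z1, W1 = Y ++ b :: Z1) ∨ ∃ Y1, Y = W1 ++ Δ.rev y :: Y1 ∧ h ∈ Y1) →
          Δ.Detour T N p r l h b Z := by
        intro W1 W2 hW hpos
        have hlX' : l = (X ++ W1) ++ Δ.rev y :: W2 := by rw [hlX, hW]; simp
        have hlp' : Δ.IsPath T ((X ++ W1) ++ Δ.rev y :: W2) := hlX' ▸ hl.path
        have hry : Δ.rev y ∉ c' ++ (e ++ y :: f) := hc.path.rev_not_mem hyc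
        have hWmem : ∀ x ∈ W1 ++ [Δ.rev y], x ∈ Y ++ b :: Z := by
          intro x hx
          rw [hW]
          simp only [List.mem_append, List.mem_cons, List.not_mem_nil, or_false] at hx ⊢
          tauto
        obtain ⟨f1, z, f2, hf, ⟨v, hvU, hzv⟩, hf2⟩ := exists_last (l := y :: f)
          (P := fun x => ∃ v ∈ W1 ++ [Δ.rev y], Δ.key x = Δ.key v)
          ⟨y, by simp, Δ.rev y, by simp, (key_rev y).symm⟩
        have hf2U : Δ.Off f2 (W1 ++ [Δ.rev y]) := fun x hx v hv hxv => hf2 x hx ⟨v, hv, hxv⟩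
        rw [hf] at hc hcp hry hcN ho''
        have hc2 : Δ.Joins T p r ((c' ++ e ++ f1) ++ z :: f2) := by simpa using hc
        have hzN : Δ.key z ∉ N := hcN z (by simp)
        have hf2X : Δ.Off f2 X := ho''.mono (by simp +contextual) (fun _ h1 => h1)
        have hf2N : ∀ x ∈ f2, Δ.key x ∉ N := fun x hx => hcN x (by simp [hx])
        rcases (Δ.key_eq _ _).1 hzv with rfl | rfl
        · have hvW1 : v ∈ W1 := by
            rcases List.mem_append.1 hvU with h1 | h1
            · exact h1
            · rw [List.mem_singleton] at h1
              exact absurd (by simp [h1]) hry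
          obtain ⟨W11, W12, rfl⟩ := List.append_of_mem hvW1
          have hlX2 : l = (X ++ W11) ++ v :: (W12 ++ Δ.rev y :: W2) := by simp [hlX']
          have hΛ : Δ.Joins T p r ((X ++ W11) ++ v :: f2) :=
            Joins.splice (hlX2 ▸ hl) hc2
              (off_append_left.2 ⟨hf2X.symm, hf2U.symm.mono (by simp +contextual) fun _ h1 => h1⟩)
          by_cases hΛN : ∃ x ∈ (X ++ W11) ++ v :: f2, Δ.key x ∈ N
          · exfalso
            obtain ⟨w, W13, hw⟩ := List.exists_cons_of_ne_nil
              (show W12 ++ [Δ.rev y] ≠ [] by simp)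
            have hlX3 : l = (X ++ W11 ++ [v]) ++ w :: (W13 ++ W2) := by
              rw [← List.cons_append, ← hw]; simp [hlX2]
            have hstep : T v w :=
              (List.isChain_append.1 (hlX3 ▸ hl.path.chain)).2.2 v (by simp) w (by simp)
            have hwf : w ∈ f2 := by
              rcases hmin _ _ hΛ hΛN hc2 (by simpa using hcN) v w hstep with h1 | h1
              · exact hΛ.path.mem_of_traverses_succ h1
              · exact hc2.path.mem_of_traverses_succ h1
            refine hf2U w hwf w ?_ rfl
            have : w ∈ W12 ++ [Δ.rev y] := by simp [hw]
            clear ih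
            grind
          · push Not at hΛN
            obtain ⟨Y', rfl⟩ : ∃ Y', Y = (W11 ++ [v]) ++ Y' :=
              exists_cons_of_append_eq (B := W12 ++ Δ.rev y :: W2) (b := b) (E := Z)
                (by rw [hW]; simp)
                (fun h1 => hΛN b (by simp only [List.mem_append, List.mem_cons, List.not_mem_nil, or_false] at h1 ⊢; tauto) hb)
            have hh' : h ∈ Y' := by
              by_contra h1
              exact hΛN h (by clear ih; grind) hh
            refine ih (X ++ W11 ++ [v]) Y' (X ++ W11 ++ [v]) f2 (by simp at hn ⊢; omega)
              (by simp [hlX]) hh' (by simp) (by simp) (by simpa using hΛ) (by simpa using hΛN)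
              ?_ ?_
            · have h1 : Δ.IsPath T ((X ++ W11 ++ [v]) ++ (Y' ++ b :: Z)) := by simpa using hlp
              exact h1.off
            · have h1 : Δ.IsPath T ((c' ++ e ++ f1 ++ [v]) ++ f2) := by simpa using hc2.path
              refine off_append_right.2 ⟨off_append_right.2 ⟨hf2X, hf2U.mono (fun _ h1 => h1) (by simp +contextual)⟩, ?_⟩
              exact h1.off.symm.mono (fun _ h1 => h1) (by simp)
        · obtain ⟨U1, U2, hU⟩ := List.append_of_mem hvU
          have hP : Δ.IsPath T ((c' ++ e ++ Δ.revList U2) ++ z :: Δ.revList U1) := by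
            have h1 : Δ.IsPath T ([] ++ y :: Δ.revList W1) := by
              have h2 : Δ.IsPath T (X ++ ((W1 ++ [Δ.rev y]) ++ W2)) := by simpa using hlp'
              simpa [Δ.rev_rev] using h2.right.left.revList hT
            have h3 : Δ.IsPath T ((c' ++ e) ++ y :: f) := by rw [hf]; exact hcp
            have h4 := h3.splice h1 (off_revList_right.2 (hce.mono (fun _ h1 => h1) (by clear ih; grind)))
            have h5 : Δ.revList (W1 ++ [Δ.rev y]) = Δ.revList (U1 ++ Δ.rev z :: U2) := by rw [hU]
            simp only [revList_append, revList_cons, revList_nil, Δ.rev_rev, List.nil_append,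
              List.singleton_append, List.append_assoc] at h5
            rw [h5] at h4
            simpa using h4
          have hΛ : Δ.Joins T p r ((c' ++ e ++ Δ.revList U2) ++ z :: f2) := by
            refine ⟨hP.splice hc2.path ?_, ?_, ?_⟩
            · refine off_append_left.2 ⟨?_, off_revList_left.2 (hf2U.symm.mono (by clear ih; grind) fun _ h1 => h1)⟩
              exact hc2.path.off.mono (fun _ h1 => List.mem_append_left _ h1) (by simp +contextual)
            · rw [← hc.head]
              obtain ⟨x, t, rfl⟩ := List.exists_cons_of_ne_nil hc'
              simp
            · rw [← hc2.last]; simp [List.getLast?_append, List.getLast?_cons]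
          obtain ⟨U3, hU3⟩ : ∃ U3, Δ.rev z :: U2 = U3 ++ [Δ.rev y] := by
            rcases List.eq_nil_or_concat (Δ.rev z :: U2) with h1 | ⟨U3, x, h1⟩
            · simp at h1
            · refine ⟨U3, ?_⟩
              rw [h1] at hU ⊢
              have h2 : W1 ++ [Δ.rev y] = (U1 ++ U3) ++ [x] := by simpa using hU
              have h3 := List.append_inj_right' h2 rfl
              simpa using h3.symm
          have hΛ' : c' ++ e ++ Δ.revList U2 ++ z :: f2 = (c' ++ e) ++ y :: (Δ.revList U3 ++ f2) := by
            have := congrArg Δ.revList hU3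
            simp only [revList_append, revList_cons, revList_nil, Δ.rev_rev, List.nil_append,
              List.singleton_append] at this
            calc _ = c' ++ e ++ (Δ.revList U2 ++ [z]) ++ f2 := by simp
              _ = _ := by rw [this]; simp
          have hlX4 : l = (X ++ U1) ++ ((Δ.rev z :: U2) ++ W2) := by
            calc l = X ++ (W1 ++ [Δ.rev y]) ++ W2 := by simp [hlX']
              _ = _ := by rw [hU]; simp
          by_cases hΛN : ∃ x ∈ (c' ++ e ++ Δ.revList U2) ++ z :: f2, Δ.key x ∈ N
          · exfalso
            rcases W2 with _ | ⟨w, W2⟩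
            · have := hl.last
              rw [hlX'] at this
              simp at this
              exact hry (this ▸ hc.mem_last)
            · have hlX3 : l = (X ++ W1 ++ [Δ.rev y]) ++ w :: W2 := by simp [hlX']
              have hstep : T (Δ.rev y) w :=
                (List.isChain_append.1 (hlX3 ▸ hl.path.chain)).2.2 _ (by simp) w (by simp)
              have hstep' : T (Δ.rev w) y := by simpa [Δ.rev_rev] using hT _ _ hstep
              have hwe : Δ.rev w ∈ c' ++ e := by
                rcases hmin _ _ hΛ hΛN hc (by simpa using hcN) _ _ hstep' with h1 | h1
                · rw [hΛ'] at h1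
                  exact (hΛ' ▸ hΛ.path).mem_of_traverses_pred h1
                · rw [← hf, ← List.append_assoc] at h1
                  rw [← hf] at hcp
                  exact hcp.mem_of_traverses_pred h1
              exact hce _ hwe w (by simp [hW]) (key_rev w)
          · push Not at hΛN
            rcases hpos with ⟨Z1, rfl⟩ | ⟨Y1, rfl, hhY1⟩
            · have h2 : b ∉ Δ.rev z :: U2 := by
                intro h2
                rcases List.mem_cons.1 h2 with h2 | h2
                · exact hzN (by rw [← key_rev, ← h2]; exact hb)
                · exact hΛN (Δ.rev b) (by simp [Δ.rev_rev, h2]) (by rwa [key_rev])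
              obtain ⟨U4, rfl⟩ := exists_append_cons_of_append_eq (A := Y) (B := Z1 ++ [Δ.rev y])
                (by simpa using hU) h2
              obtain ⟨Y0, Y1, rfl⟩ := List.append_of_mem hhY
              refine ⟨_, hΛ, hΛN, Or.inl ⟨X ++ Y0, Y1, by simp [hlX], ?_⟩⟩
              have h3 : Δ.Off (Δ.rev z :: U2) (h :: Y1) :=
                (hlX4 ▸ hl.path).off.symm.mono (by simp +contextual) (by simp +contextual)
              rw [hΛ', off_append_left]
              refine ⟨hce.mono (fun _ h1 => h1) (by simp +contextual), ?_⟩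
              rw [← List.cons_append, off_append_left]
              refine ⟨?_, hf2U.mono (fun _ h1 => h1) (by simp +contextual)⟩
              rw [← off_revList_left, hU3] at h3
              simpa [Δ.rev_rev] using h3
            · have hlX5 : l = (X ++ (U1 ++ Δ.rev z :: U2)) ++ ((Y1) ++ b :: Z) := by
                rw [← hU, hlX]; simp
              have hlp5 : Δ.IsPath T ((X ++ (U1 ++ Δ.rev z :: U2)) ++ ((Y1) ++ b :: Z)) :=
                hlX5 ▸ hl.path
              refine ih (X ++ (U1 ++ Δ.rev z :: U2)) Y1 (c' ++ e ++ Δ.revList (Δ.rev z :: U2)) f2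
                (by simp at hn ⊢; omega) hlX5 hhY1 (by simp [hX]) (by simp)
                (by simpa [Δ.rev_rev] using hΛ) (by simpa [Δ.rev_rev] using hΛN) ?_ ?_
              · rw [off_append_left, off_revList_left]
                refine ⟨hce.mono (fun _ h1 => h1) (by simp +contextual), ?_⟩
                exact hlp5.off.mono (by simp +contextual) (fun _ h1 => h1)
              · rw [← hU, off_append_right]
                exact ⟨hf2X, hf2U⟩
      obtain ⟨Y0, Y1, rfl⟩ := List.append_of_mem hhY
      have hryb : Δ.rev y ≠ b := fun h1 => hyN (by rw [← key_rev, h1]; exact hb)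
      have hryh : Δ.rev y ≠ h := fun h1 => hyN (by rw [← key_rev, h1]; exact hh)
      have hvW' : Δ.rev y ∈ Y0 ∨ Δ.rev y ∈ Y1 ∨ Δ.rev y ∈ Z := by
        simp only [List.mem_append, List.mem_cons] at hvW
        tauto
      rcases hvW' with h1 | h1 | h1
      · obtain ⟨W1, W2, rfl⟩ := List.append_of_mem h1
        exact key2 W1 (W2 ++ h :: Y1 ++ b :: Z) (by simp)
          (Or.inr ⟨W2 ++ h :: Y1, by simp, by simp⟩)
      · obtain ⟨Y2, Y3, rfl⟩ := List.append_of_mem h1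
        have h2 : Δ.IsPath T ((X ++ Y0) ++ ((h :: (Y2 ++ [Δ.rev y])) ++ (Y3 ++ b :: Z))) := by
          simpa using hlp
        have h3 : Δ.IsPath T ([] ++ y :: (Δ.revList (h :: Y2))) := by
          simpa [Δ.rev_rev] using h2.right.left.revList hT
        have h4 := hcp.splice h3 (off_revList_right.2
          (hce.mono (fun _ h1 => h1) (by simp only [List.mem_append, List.mem_cons]; tauto)))
        refine ⟨_, hc, hcN, Or.inr ⟨_, ⟨h4, ?_, ?_⟩, ?_, ?_⟩⟩
        · rw [← hc.head]
          obtain ⟨x, t, rfl⟩ := List.exists_cons_of_ne_nil hc'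
          simp
        · simp [List.getLast?_append, List.getLast?_cons]
        · rw [off_append_left]
          refine ⟨hce.mono (fun _ h1 => h1) (by simp +contextual), ?_⟩
          have h5 : Δ.Off (y :: Δ.revList (h :: Y2)) (Y3 ++ b :: Z) := by
            have := off_revList_left.2 h2.right.off
            simpa [Δ.rev_rev] using this
          exact h5.mono (fun _ h1 => h1) (by simp +contextual)
        · intro x hx
          rcases List.mem_append.1 hx with hx | hx
          · exact ⟨x, by simp only [List.mem_append] at hx ⊢; tauto, rfl⟩
          · rcases List.mem_cons.1 hx with rfl | hx
            · exact ⟨x, by simp, rfl⟩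
            · refine ⟨Δ.rev x, ?_, (key_rev x).symm⟩
              rw [mem_revList] at hx
              rw [hlX]
              simp only [List.mem_append, List.mem_cons] at hx ⊢
              tauto
      · obtain ⟨Z1, Z2, rfl⟩ := List.append_of_mem h1
        exact key2 (Y0 ++ h :: Y1 ++ b :: Z1) Z2 (by simp) (Or.inl ⟨Z1, rfl⟩)
variable (Δ) in
/-- A closed path. -/
structure IsClosedPath (S : D → D → Prop) (l : List D) : Prop where
  path : Δ.IsPath S l
  closed : ∀ x ∈ l.getLast?, ∀ y ∈ l.head?, S x y

namespace IsClosedPath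

theorem mono {T : D → D → Prop} {l : List D} (h : Δ.IsClosedPath S l)
    (hST : ∀ a b, S a b → T a b) : Δ.IsClosedPath T l :=
  ⟨h.path.mono hST, fun a ha b hb => hST a b (h.closed a ha b hb)⟩

theorem revList {l : List D} (h : Δ.IsClosedPath S l) (hS : Δ.Reversible S) :
    Δ.IsClosedPath S (Δ.revList l) := by
  refine ⟨h.path.revList hS, ?_⟩
  simp only [getLast?_revList, head?_revList, Option.mem_def, Option.map_eq_some_iff]
  rintro _ ⟨x, hx, rfl⟩ _ ⟨y, hy, rfl⟩
  exact hS _ _ (h.closed y hy x hx)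

theorem rotate {A B : List D} {d : D} (h : Δ.IsClosedPath S (A ++ d :: B)) :
    Δ.IsPath S (d :: B ++ A) := by
  refine h.path.right.append h.path.left h.path.off.symm (fun x hx y hy => h.closed x ?_ y ?_)
  · simp only [List.getLast?_append, List.getLast?_cons, Option.mem_def] at hx ⊢
    simp_all
  · simp only [List.head?_append, Option.mem_def] at hy ⊢
    simp_all

end IsClosedPath

variable (Δ) in
/-- From its beginning, the path `y` reaches `N` and can be continued inside `N` to the path `x`,
and then along `x` back to the beginning of `x`. -/
def Lands (S : D → D → Prop) (N : Set K) (x y : List D) : Prop :=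
  ∃ l d E w xa g xb, y = l ++ d :: E ∧ Δ.key d ∈ N ∧ (∀ v ∈ l, Δ.key v ∉ N) ∧
    x = xa ++ g :: xb ∧ Δ.key g ∈ N ∧ (∀ v ∈ w, Δ.key v ∈ N) ∧ Δ.Off w x ∧
    Δ.IsPath S (l ++ d :: w ++ Δ.rev g :: Δ.revList xa)

theorem lands_or_lands {c x y : List D} {N : Set K} (hS : Δ.Reversible S)
    (hc : Δ.IsClosedPath S c) (hN : ∀ k, k ∈ N ↔ ∃ v ∈ c, Δ.key v = k)
    (hx : Δ.IsPath S x) (hy : Δ.IsPath S y) (hxy : Δ.Off x y)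
    (hxN : ∃ v ∈ x, Δ.key v ∈ N) (hyN : ∃ v ∈ y, Δ.key v ∈ N) :
    Δ.Lands S N x y ∨ Δ.Lands S N (Δ.revList x) y := by
  obtain ⟨l, d, E, rfl, hd, hl⟩ := exists_first hyN
  obtain ⟨c', hc', hN', hd'⟩ : ∃ c', Δ.IsClosedPath S c' ∧
      (∀ k, k ∈ N ↔ ∃ v ∈ c', Δ.key v = k) ∧ d ∈ c' := by
    obtain ⟨v, hv, hvd⟩ := (hN _).1 hd
    rcases (Δ.key_eq _ _).1 hvd with rfl | rfl
    · exact ⟨c, hc, hN, hv⟩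
    · refine ⟨_, hc.revList hS, fun k => ?_, by simpa [Δ.rev_rev] using hv⟩
      rw [hN]
      constructor
      · rintro ⟨a, ha, rfl⟩; exact ⟨Δ.rev a, by simpa [Δ.rev_rev] using ha, key_rev a⟩
      · rintro ⟨a, ha, rfl⟩; exact ⟨Δ.rev a, by simpa using ha, key_rev a⟩
  obtain ⟨A, B, rfl⟩ := List.append_of_mem hd'
  have hrot := hc'.rotate
  have hNrot : ∀ v ∈ d :: B ++ A, Δ.key v ∈ N := fun v hv =>
    (hN' _).2 ⟨v, by simp only [List.mem_append, List.mem_cons] at hv ⊢; tauto, rfl⟩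
  have hmeet : ∃ v ∈ B ++ A, ∃ u ∈ x, Δ.key v = Δ.key u := by
    obtain ⟨u, hu, huN⟩ := hxN
    obtain ⟨v, hv, hvu⟩ := (hN' _).1 huN
    refine ⟨v, ?_, u, hu, hvu⟩
    have hvd : v ≠ d := by
      rintro rfl
      exact hxy u hu v (by simp) hvu.symm
    simp only [List.mem_append, List.mem_cons] at hv ⊢
    tauto
  obtain ⟨w, v, R, hR, ⟨u, hu, hvu⟩, hw⟩ := exists_first hmeet
  have hwx : Δ.Off w x := fun a ha b hb hab => hw a ha ⟨b, hb, hab⟩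
  rw [List.cons_append, hR] at hrot hNrot
  have hvN : Δ.key v ∈ N := hNrot v (by simp)
  have hwN : ∀ a ∈ w, Δ.key a ∈ N := fun a ha => hNrot a (by simp [ha])
  have h1 : Δ.IsPath S (l ++ d :: (w ++ v :: R)) :=
    hy.splice (C := []) hrot (fun a ha b hb hab => hl a ha (hab ▸ hNrot b (List.mem_cons_of_mem _ hb)))
  have h2 : Δ.IsPath S ((l ++ d :: w) ++ v :: R) := by simpa using h1
  have hoff : Δ.Off (l ++ d :: w) x := by
    rw [List.append_cons, off_append_left]
    refine ⟨hxy.symm.mono (fun a ha => ?_) fun _ h => h, hwx⟩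
    simp only [List.mem_append, List.mem_cons, List.not_mem_nil, or_false] at ha ⊢
    tauto
  rcases (Δ.key_eq _ _).1 hvu with rfl | rfl
  · obtain ⟨xa, xb, rfl⟩ := List.append_of_mem hu
    right
    refine ⟨l, d, E, w, Δ.revList xb, Δ.rev u, Δ.revList xa, rfl, hd, hl, by simp,
      by rwa [key_rev], hwN, off_revList_right.2 hwx, ?_⟩
    rw [Δ.rev_rev, revList_revList]
    exact h2.splice hx (hoff.mono (fun _ h => h) (by simp +contextual))
  · obtain ⟨xa, xb, rfl⟩ := List.append_of_mem hu
    left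
    refine ⟨l, d, E, w, xa, Δ.rev v, xb, rfl, hd, hl, rfl, by rwa [key_rev], hwN, hwx, ?_⟩
    have h3 := hx.revList hS
    rw [revList_append, revList_cons, List.append_assoc] at h3
    rw [List.singleton_append, Δ.rev_rev] at *
    exact h2.splice h3 (off_revList_right.2 (hoff.mono (fun _ h => h) (by simp +contextual)))

/-- The beginnings of a path and of its reversal are disjoint up to the last dart in `N`. -/
theorem IsPath.off_of_split {N : Set K} {z l E za zb : List D} {d g : D} (h : Δ.IsPath S z)
    (hz : z = l ++ d :: E) (hl : ∀ v ∈ l, Δ.key v ∉ N)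
    (hz' : Δ.revList z = za ++ g :: zb) (hg : Δ.key g ∈ N) : Δ.Off l za := by
  have h1 : z = Δ.revList zb ++ Δ.rev g :: Δ.revList za := by
    rw [← revList_revList z, hz']; simp
  obtain ⟨C', hC'⟩ := exists_cons_of_append_eq (hz.symm.trans h1)
    (fun h2 => hl _ h2 (by rwa [key_rev]))
  rw [h1] at h
  have h2 := off_revList_right.1 (h.off.mono (m' := Δ.revList za) (fun _ h => h) (by simp +contextual))
  exact h2.mono (fun a ha => by rw [hC']; simp [ha]) (fun _ h => h)

variable (Δ) in
/-- Two paths between prescribed sets of darts; the underlying edges common to both lie in `N`, or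
on `x` but not on `c`. -/
def Linked (S : D → D → Prop) (N : Set K) (P Q : Set D) (x c : List D) : Prop :=
  ∃ α β, (∃ a ∈ P, ∃ z ∈ Q, Δ.Joins S a z α) ∧ (∃ a ∈ P, ∃ z ∈ Q, Δ.Joins S a z β) ∧
    ∀ u ∈ α, ∀ v ∈ β, Δ.key u = Δ.key v → Δ.key u ∉ N →
      (∃ a ∈ x, Δ.key u = Δ.key a) ∧ ∀ a ∈ c, Δ.key u ≠ Δ.key a

theorem joins_of_lands {l E w xa xb x y : List D} {d g p q r s : D}
    (hx : Δ.Joins S p r x) (hy : Δ.Joins S q s y) (h1 : y = l ++ d :: E) (h2 : x = xa ++ g :: xb)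
    (h : Δ.IsPath S (l ++ d :: w ++ Δ.rev g :: Δ.revList xa)) :
    Δ.Joins S q (Δ.rev p) (l ++ d :: w ++ Δ.rev g :: Δ.revList xa) := by
  refine ⟨h, ?_, ?_⟩
  · rw [← hy.head, h1]; cases l <;> simp
  · have := hx.head
    rw [h2] at this
    rw [List.getLast?_append, List.getLast?_cons, getLast?_revList]
    cases xa <;> simp_all

theorem exists_key_of_mem {N : Set K} {l w xa : List D} {d g u : D} (hd : Δ.key d ∈ N)
    (hg : Δ.key g ∈ N) (hw : ∀ v ∈ w, Δ.key v ∈ N)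
    (hu : u ∈ l ++ d :: w ++ Δ.rev g :: Δ.revList xa) (huN : Δ.key u ∉ N) :
    ∃ v, Δ.key u = Δ.key v ∧ (v ∈ l ∨ v ∈ xa) := by
  simp only [List.mem_append, List.mem_cons, mem_revList] at hu
  rcases hu with (h | rfl | h) | rfl | h
  · exact ⟨u, rfl, Or.inl h⟩
  · exact absurd hd huN
  · exact absurd (hw u h) huN
  · exact absurd (by rwa [key_rev]) huN
  · exact ⟨_, (key_rev u).symm, Or.inr h⟩

theorem linked_of_lands {N : Set K} {x y c : List D} {p q r s : D} (hS : Δ.Reversible S)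
    (hx : Δ.Joins S p r x) (hy : Δ.Joins S q s y) (hxy : Δ.Off x y)
    (h1 : Δ.Lands S N x y) (h2 : Δ.Lands S N (Δ.revList y) (Δ.revList x)) :
    Δ.Linked S N {p, Δ.rev r} {s, Δ.rev q} x c := by
  obtain ⟨l, d, E, w, xa, g, xb, hyd, hd, hl, hxg, hg, hw, -, hα⟩ := h1
  obtain ⟨l', d', E', w', ya, g', yb, hxd', hd', hl', hyg', hg', hw', -, hβ⟩ := h2
  have hα' := (joins_of_lands hx hy hyd hxg hα).revList hS
  have hβ' := joins_of_lands (hy.revList hS) (hx.revList hS) hxd' hyg' hβ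
  rw [Δ.rev_rev] at hα' hβ'
  refine ⟨_, _, ⟨p, by simp, _, by simp, hα'⟩, ⟨_, by simp, _, by simp, hβ'⟩, ?_⟩
  have o1 := hy.path.off_of_split hyd hl hyg' hg'
  have o2 := (hx.path.revList hS).off_of_split hxd' hl' (by simpa using hxg) hg
  have o3 : Δ.Off x (Δ.revList y) := off_revList_right.2 hxy
  have o4 : Δ.Off (Δ.revList x) y := off_revList_left.2 hxy
  intro u hu v hv huv huN
  exfalso
  rw [mem_revList] at hu
  obtain ⟨u', hu'', hu'⟩ := exists_key_of_mem hd hg hw hu (by rwa [key_rev])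
  obtain ⟨v', hv'', hv'⟩ := exists_key_of_mem hd' hg' hw' hv (huv ▸ huN)
  have huv' : Δ.key u' = Δ.key v' := by rw [← hu'', ← hv'', key_rev, huv]
  rcases hu' with hu' | hu' <;> rcases hv' with hv' | hv'
  · exact o4 v' (by simp [hxd', hv']) u' (by simp [hyd, hu']) huv'.symm
  · exact o1 u' hu' v' hv' huv'
  · exact o2 v' hv' u' hu' huv'.symm
  · exact o3 u' (by simp [hxg, hu']) v' (by simp [hyg', hv']) huv'

theorem linked_of_minimal {T : D → D → Prop} {N : Set K} {x y : List D} {p r q s : D}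
    (hS : Δ.Reversible S) (hT : Δ.Reversible T) (hTS : ∀ a b, T a b → S a b)
    (hmin : Δ.IsMinimalFor T N p r) (hx : Δ.Joins T p r x) (hy : Δ.Joins S q s y)
    (hxy : Δ.Off x y) {c : List D} (hc : Δ.Joins T p r c) (hcN : ∀ a ∈ c, Δ.key a ∉ N)
    (hTy : ∀ c, Δ.Joins T p r c → Δ.Off c y)
    (h1 : Δ.Lands S N x y) (h2 : Δ.Lands S N (Δ.revList x) (Δ.revList y))
    (h3 : Δ.Lands S N y (Δ.revList x)) :
    ∃ c, Δ.Joins T p r c ∧ (∀ a ∈ c, Δ.key a ∉ N) ∧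
      Δ.Linked S N {p, Δ.rev r} {s, Δ.rev q} x c := by
  have hxS := hx.mono hTS
  obtain ⟨l₁, d₁, E₁, w₁, xa₁, g₁, xb₁, hd1, hdN1, hl1, hg1, hgN1, hw1, ho1, hp1⟩ := h1
  obtain ⟨l₂, d₂, E₂, w₂, xa₂, g₂, xb₂, hd2, hdN2, hl2, hg2, hgN2, hw2, ho2, hp2⟩ := h2
  obtain ⟨l₃, d₃, E₃, w₃, xa₃, g₃, xb₃, hd3, hdN3, hl3, hg3, hgN3, hw3, ho3, hp3⟩ := h3
  have hj1 := joins_of_lands hxS hy hd1 hg1 hp1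
  have hj2 := joins_of_lands (hxS.revList hS) (hy.revList hS) hd2 hg2 hp2
  have hj3 := joins_of_lands hy (hxS.revList hS) hd3 hg3 hp3
  have o12 := hy.path.off_of_split hd1 hl1 hd2 hdN2
  have o23 := (hy.path.revList hS).off_of_split hd2 hl2 (by simpa using hg3) hgN3
  have o13 := (hx.path.revList hT).off_of_split hd3 hl3 (by simpa using hg1) hgN1
  have hxb : x = Δ.revList E₃ ++ Δ.rev d₃ :: Δ.revList l₃ := by
    rw [← revList_revList x, hd3]; simp
  have hxh : x = Δ.revList xb₂ ++ Δ.rev g₂ :: Δ.revList xa₂ := by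
    rw [← revList_revList x, hg2]; simp
  rw [Δ.rev_rev] at hj2
  -- the case of a path leaving free the part of `x` used twice
  have hfree : ∀ c, Δ.Joins T p r c → (∀ a ∈ c, Δ.key a ∉ N) →
      (∀ v ∈ xa₂, v ∈ l₃ ∨ ∀ a ∈ c, Δ.key v ≠ Δ.key a) →
      Δ.Linked S N {p, Δ.rev r} {s, Δ.rev q} x c := by
    intro c hc hcN hfr
    have hj1' := hj1.revList hS
    have hj2' := hj2.revList hS
    rw [Δ.rev_rev] at hj1'
    rw [Δ.rev_rev] at hj2'
    refine ⟨_, _, ⟨p, by simp, _, by simp, hj1'⟩, ⟨_, by simp, _, by simp, hj2'⟩, ?_⟩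
    intro u hu v hv huv huN
    rw [mem_revList] at hu hv
    obtain ⟨u', hu'', hu'⟩ := exists_key_of_mem hdN1 hgN1 hw1 hu (by rwa [key_rev])
    obtain ⟨v', hv'', hv'⟩ := exists_key_of_mem hdN2 hgN2 hw2 hv (by rw [key_rev]; exact huv ▸ huN)
    rw [key_rev] at hu'' hv''
    have huv' : Δ.key u' = Δ.key v' := by rw [← hu'', ← hv'', huv]
    have hxy' := off_revList_left.2 (off_revList_right.2 hxy)
    rcases hu' with hu' | hu' <;> rcases hv' with hv' | hv'
    · exact absurd huv' (o12 u' hu' v' hv')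
    · exact absurd huv'.symm (off_revList_left.2 hxy v' (by simp [hg2, hv']) u' (by simp [hd1, hu']))
    · exact absurd huv' (off_revList_right.2 hxy u' (by simp [hg1, hu']) v' (by simp [hd2, hv']))
    · refine ⟨⟨u', by simp [hg1, hu'], hu''⟩, fun a ha => ?_⟩
      rcases hfr v' hv' with h | h
      · exact absurd huv'.symm (o13 v' h u' hu')
      · rw [huv, hv'']; exact h a ha
  have hZ : ∀ v ∈ Δ.revList l₃, Δ.key v ∉ N := fun v hv => by
    rw [mem_revList] at hv; rw [← key_rev]; exact hl3 _ hv
  have hhN : Δ.key (Δ.rev g₂) ∈ N := by rwa [key_rev]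
  have hbN : Δ.key (Δ.rev d₃) ∈ N := by rwa [key_rev]
  have hpos : Δ.rev g₂ ∈ Δ.revList E₃ ∨ Δ.rev g₂ = Δ.rev d₃ := by
    have : Δ.rev g₂ ∈ x := by rw [hxh]; simp
    rw [hxb, List.mem_append, List.mem_cons] at this
    rcases this with h | h | h
    · exact Or.inl h
    · exact Or.inr h
    · exact absurd hhN (hZ _ h)
  rcases hpos with hpos | hpos
  · obtain ⟨Y, hY⟩ : ∃ Y, Δ.revList E₃ = p :: Y := by
      have := hx.head
      rw [hxb] at this
      cases h : Δ.revList E₃ with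
      | nil => simp [h] at hpos
      | cons a Y => rw [h] at this; exact ⟨Y, by simpa using this⟩
    obtain ⟨t, rfl⟩ : ∃ t, c = p :: t := by
      cases c with
      | nil => simpa using hc.head
      | cons a t => exact ⟨t, by simpa using hc.head⟩
    have hhY : Δ.rev g₂ ∈ Y := by
      rw [hY] at hpos
      refine (List.mem_cons.1 hpos).resolve_left fun h => hcN p (by simp) (h ▸ hhN)
    have hxb' : x = [p] ++ (Y ++ Δ.rev d₃ :: Δ.revList l₃) := by rw [hxb, hY]; simp
    have hoff1 : Δ.Off [p] (Y ++ Δ.rev d₃ :: Δ.revList l₃) :=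
      (hxb' ▸ hx.path : Δ.IsPath T ([p] ++ (Y ++ Δ.rev d₃ :: Δ.revList l₃))).off
    have hoff2 : Δ.Off t [p] := (hc.path : Δ.IsPath T ([p] ++ t)).off.symm
    obtain ⟨c, hc, hcN, ⟨X', Y', hX', hXY'⟩ | ⟨α, hα, hαo, hαk⟩⟩ :=
      detour_of_append hT hmin hx hhN hbN hZ _ [p] Y [p] t le_rfl hxb' hhY (by simp) (by simp)
        hc hcN hoff1 hoff2
    · refine ⟨c, hc, hcN, hfree c hc hcN fun v hv => ?_⟩
      have h4 := ((hxh ▸ hx.path).append_cons_inj (hX'.symm.trans hxh)).2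
      have hv' : Δ.rev v ∈ Y' ++ Δ.rev d₃ :: Δ.revList l₃ := by
        rw [h4, mem_revList, Δ.rev_rev]; exact hv
      simp only [List.mem_append, List.mem_cons, mem_revList, Δ.rev_rev, rev_inj] at hv'
      rcases hv' with h | h | h
      · right
        intro a ha
        rw [← key_rev]
        exact (hXY' a ha _ (by simp [h])).symm
      · right
        intro a ha hva
        exact hcN a ha (by rw [← hva, h]; exact hdN3)
      · exact Or.inl h
    · have hα' := (hα.mono hTS).revList hS
      rw [Δ.rev_rev] at hα'
      obtain ⟨t', ht'⟩ : ∃ t', Δ.revList α = Δ.rev g₂ :: t' := by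
        have := hα'.head
        cases h : Δ.revList α with
        | nil => simp [h] at this
        | cons a t' => rw [h] at this; exact ⟨t', by simpa using this⟩
      have hcy := hTy c hc
      have hαy : Δ.Off α y := by
        intro a ha b hb hab
        obtain ⟨a', ha', haa'⟩ := hαk a ha
        rcases List.mem_append.1 ha' with h | h
        · exact hcy a' h b hb (haa' ▸ hab)
        · exact hxy a' h b hb (haa' ▸ hab)
      have hw₂ : Δ.Off w₂ α := by
        intro a ha b hb hab
        obtain ⟨b', hb', hbb'⟩ := hαk b hb
        rcases List.mem_append.1 hb' with h | h
        · exact hcN b' h (hbb' ▸ hab ▸ hw2 a ha)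
        · exact off_revList_right.1 ho2 a ha b' h (hab.trans hbb')
      have hpath : Δ.IsPath S ((l₂ ++ d₂ :: w₂) ++ Δ.rev g₂ :: t') := by
        refine hp2.splice (C := []) (ht' ▸ hα'.path) ?_
        have h6 : Δ.Off (l₂ ++ d₂ :: w₂) (Δ.revList α) := by
          rw [off_revList_right, List.append_cons, off_append_left]
          refine ⟨(off_revList_right.2 hαy).symm.mono (fun a ha => ?_) fun _ h => h, hw₂⟩
          rw [hd2]
          simp only [List.mem_append, List.mem_cons, List.not_mem_nil, or_false] at ha ⊢
          tauto
        exact h6.mono (fun _ h => h) (by rw [ht']; simp +contextual)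
      have hj4 : Δ.Joins S (Δ.rev s) (Δ.rev p) ((l₂ ++ d₂ :: w₂) ++ Δ.rev g₂ :: t') := by
        refine ⟨hpath, ?_, ?_⟩
        · rw [← hj2.head]; cases l₂ <;> simp
        · rw [← hα'.last, ht']; simp [List.getLast?_append, List.getLast?_cons]
      have hj4' := hj4.revList hS
      rw [Δ.rev_rev, Δ.rev_rev] at hj4'
      refine ⟨c, hc, hcN, _, _, ⟨p, by simp, s, by simp, hj4'⟩, ⟨_, by simp, _, by simp, hj3⟩, ?_⟩
      intro u hu v hv huv huN
      exfalso
      obtain ⟨v', hv'', hv'⟩ := exists_key_of_mem hdN3 hgN3 hw3 hv (huv ▸ huN)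
      obtain ⟨u', hu'', hu'⟩ : ∃ u', Δ.key u = Δ.key u' ∧ (u' ∈ l₂ ∨ u' ∈ α) := by
        rw [← key_rev]
        rw [← key_rev] at huN
        rw [mem_revList, ← ht'] at hu
        simp only [List.mem_append, List.mem_cons, mem_revList] at hu
        rcases hu with (h | h | h) | h
        · exact ⟨_, rfl, Or.inl h⟩
        · exact absurd (h ▸ hdN2) huN
        · exact absurd (hw2 _ h) huN
        · exact ⟨_, (key_rev _).symm, Or.inr h⟩
      have huv' : Δ.key u' = Δ.key v' := by rw [← hu'', ← hv'', huv]
      rcases hu' with hu' | hu' <;> rcases hv' with hv' | hv'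
      · exact off_revList_left.2 (off_revList_right.2 hxy) v' (by simp [hd3, hv']) u'
          (by simp [hd2, hu']) huv'.symm
      · exact o23 u' hu' v' hv' huv'
      · exact off_revList_right.1 (hαo.mono (m' := Δ.revList l₃) (fun _ h => h)
          (by simp +contextual)) u' hu' v' hv' huv'
      · exact hαy u' hu' v' (by simp [hg3, hv']) huv'
  · refine ⟨c, hc, hcN, hfree c hc hcN fun v hv => Or.inl ?_⟩
    rw [hpos] at hxh
    have := ((hxb ▸ hx.path).append_cons_inj (hxh.symm.trans hxb)).2
    have h5 := congrArg Δ.revList this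
    simp only [revList_revList] at h5
    exact h5 ▸ hv

variable (Δ) in
/-- Two paths joining `p` to `r`, the first one meeting `N` and the second one avoiding it. -/
def HasPair (N : Set K) (p r : D) (T : D → D → Prop) : Prop :=
  Δ.Reversible T ∧ ∃ l c, Δ.Joins T p r l ∧ (∃ v ∈ l, Δ.key v ∈ N) ∧ Δ.Joins T p r c ∧
    ∀ v ∈ c, Δ.key v ∉ N

theorem traverses_rev {l : List D} {a b : D} :
    Δ.Traverses l (Δ.rev b) (Δ.rev a) ↔ Δ.Traverses l a b := by
  simp only [Traverses, Δ.rev_rev]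
  exact or_comm

theorem Joins.traverses {l : List D} {p r : D} (h : Δ.Joins S p r l) :
    Δ.Joins (fun a b => S a b ∧ Δ.Traverses l a b) p r l := by
  refine ⟨⟨?_, h.path.pairwise⟩, h.head, h.last⟩
  have h1 := h.path.chain
  rw [List.isChain_iff_forall_rel_of_append_cons_cons] at h1 ⊢
  intro a b l₁ l₂ hl
  exact ⟨h1 hl, Or.inl ⟨l₁, l₂, by simp [hl]⟩⟩

theorem isMinimalFor_of_minimal {N : Set K} {p r : D} {T : D → D → Prop}
    (h : Minimal (Δ.HasPair N p r) T) : Δ.IsMinimalFor T N p r := by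
  intro l c hl hlN hc hcN a b hab
  refine (h.le_of_le (y := fun a b => T a b ∧ (Δ.Traverses l a b ∨ Δ.Traverses c a b))
    ⟨fun a b hab => ⟨h.prop.1 _ _ hab.1, ?_⟩, l, c, hl.traverses.mono ?_, hlN,
      hc.traverses.mono ?_, hcN⟩ (fun a b hab => hab.1) a b hab).2
  · simpa only [traverses_rev] using hab.2
  · exact fun a b h => ⟨h.1, Or.inl h.2⟩
  · exact fun a b h => ⟨h.1, Or.inr h.2⟩

/-- The relation obtained by only allowing the underlying edges in `L`. -/
theorem Joins.restrict {l : List D} {p r : D} {L : Set K} (h : Δ.Joins S p r l)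
    (hl : ∀ v ∈ l, Δ.key v ∈ L) :
    Δ.Joins (fun a b => S a b ∧ Δ.key a ∈ L ∧ Δ.key b ∈ L) p r l := by
  refine ⟨⟨?_, h.path.pairwise⟩, h.head, h.last⟩
  have h1 := h.path.chain
  rw [List.isChain_iff_forall_rel_of_append_cons_cons] at h1 ⊢
  intro a b l₁ l₂ hl'
  exact ⟨h1 hl', hl a (by simp [hl']), hl b (by simp [hl'])⟩

theorem Joins.key_mem {l : List D} {p r : D} {L : Set K}
    (h : Δ.Joins (fun a b => S a b ∧ Δ.key a ∈ L ∧ Δ.key b ∈ L) p r l) (hp : Δ.key p ∈ L) :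
    ∀ v ∈ l, Δ.key v ∈ L := by
  obtain ⟨t, rfl⟩ : ∃ t, l = p :: t := by
    have := h.head
    cases l with
    | nil => simp at this
    | cons a t => exact ⟨t, by simpa using this⟩
  exact h.path.chain.induction (fun v => Δ.key v ∈ L) _ (fun _ _ hxy _ => hxy.2.2)
    (by simpa using hp)

theorem exists_linked [Finite D] {N : Set K} {p r q s : D} {x c₃ y c₄ c₅ : List D}
    (hS : Δ.Reversible S) (hx : Δ.Joins S p r x) (hc₃ : Δ.Joins S p r c₃)
    (hy : Δ.Joins S q s y) (hc₅ : Δ.IsClosedPath S c₅)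
    (hN : ∀ k, k ∈ N ↔ ∃ v ∈ c₅, Δ.key v = k) (hxN : ∃ v ∈ x, Δ.key v ∈ N)
    (hyN : ∃ v ∈ y, Δ.key v ∈ N) (hc₃N : ∀ v ∈ c₃, Δ.key v ∉ N) (hc₄N : ∀ v ∈ c₄, Δ.key v ∉ N)
    (hoff : Δ.Off (x ++ c₃) (y ++ c₄)) :
    ∃ c α β, Δ.Joins S p r c ∧ (∀ v ∈ c, ∃ u ∈ x ++ c₃, Δ.key v = Δ.key u) ∧
      (∃ a ∈ ({p, Δ.rev r} : Set D), ∃ z ∈ ({s, Δ.rev q} : Set D), Δ.Joins S a z α) ∧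
      (∃ a ∈ ({p, Δ.rev r} : Set D), ∃ z ∈ ({s, Δ.rev q} : Set D), Δ.Joins S a z β) ∧
      ∀ u ∈ α, ∀ v ∈ β, Δ.key u = Δ.key v → ∀ a ∈ c ++ c₄, Δ.key u ≠ Δ.key a := by
  set L : Set K := {k | ∃ u ∈ x ++ c₃, k = Δ.key u} with hL
  have hpL : Δ.key p ∈ L := ⟨p, by simp [hx.mem_head], rfl⟩
  set S' := fun a b => S a b ∧ Δ.key a ∈ L ∧ Δ.key b ∈ L with hS'
  have h0 : Δ.HasPair N p r S' := by
    refine ⟨fun a b h => ⟨hS _ _ h.1, ?_, ?_⟩, x, c₃, hx.restrict ?_, hxN, hc₃.restrict ?_, hc₃N⟩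
    · rw [key_rev]; exact h.2.2
    · rw [key_rev]; exact h.2.1
    · exact fun v hv => ⟨v, by simp [hv], rfl⟩
    · exact fun v hv => ⟨v, by simp [hv], rfl⟩
  obtain ⟨T, hTS', hT⟩ := (Set.toFinite {T | Δ.HasPair N p r T}).exists_le_minimal h0
  have hTS : ∀ a b, T a b → S a b := fun a b h => (hTS' a b h).1
  obtain ⟨hTr, l, c, hl, hlN, hc, hcN⟩ := hT.prop
  have hTL : ∀ m, Δ.Joins T p r m → ∀ v ∈ m, Δ.key v ∈ L :=
    fun m hm => (hm.mono (fun a b h => hTS' a b h)).key_mem hpL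
  have hTy : ∀ m, Δ.Joins T p r m → Δ.Off m (y ++ c₄) := by
    intro m hm a ha b hb hab
    obtain ⟨u, hu, hau⟩ := hTL m hm a ha
    exact hoff u hu b hb (hau ▸ hab)
  have hly : Δ.Off l y := (hTy l hl).mono (fun _ h => h) (by simp +contextual)
  have hlc : Δ.Off l c₄ := (hTy l hl).mono (fun _ h => h) (by simp +contextual)
  have hlS := hl.mono hTS
  suffices h : ∃ c, Δ.Joins T p r c ∧ (∀ a ∈ c, Δ.key a ∉ N) ∧
      Δ.Linked S N {p, Δ.rev r} {s, Δ.rev q} l c by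
    obtain ⟨c, hc, hcN, α, β, hα, hβ, hαβ⟩ := h
    refine ⟨c, α, β, hc.mono hTS, hTL c hc, hα, hβ, fun u hu v hv huv a ha hua => ?_⟩
    by_cases huN : Δ.key u ∈ N
    · rcases List.mem_append.1 ha with h | h
      · exact hcN a h (hua ▸ huN)
      · exact hc₄N a h (hua ▸ huN)
    · obtain ⟨⟨b, hb, hub⟩, h2⟩ := hαβ u hu v hv huv huN
      rcases List.mem_append.1 ha with h | h
      · exact h2 a h hua
      · exact hlc b hb a h (hub ▸ hua)
  have hyS := hy.revList hS
  have hlrS := hlS.revList hS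
  have hlN' : ∃ v ∈ Δ.revList l, Δ.key v ∈ N := by
    obtain ⟨v, hv, hvN⟩ := hlN
    exact ⟨Δ.rev v, by simpa [Δ.rev_rev], by rwa [key_rev]⟩
  have hyN' : ∃ v ∈ Δ.revList y, Δ.key v ∈ N := by
    obtain ⟨v, hv, hvN⟩ := hyN
    exact ⟨Δ.rev v, by simpa [Δ.rev_rev], by rwa [key_rev]⟩
  have o1 : Δ.Off l (Δ.revList y) := off_revList_right.2 hly
  have o2 : Δ.Off (Δ.revList l) y := off_revList_left.2 hly
  have o3 : Δ.Off (Δ.revList l) (Δ.revList y) := off_revList_right.2 o2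
  have hA := lands_or_lands hS hc₅ hN hlS.path hy.path hly hlN hyN
  have hB := lands_or_lands hS hc₅ hN hlS.path hyS.path o1 hlN hyN'
  have hC := lands_or_lands hS hc₅ hN hy.path hlS.path hly.symm hyN hlN
  have hD := lands_or_lands hS hc₅ hN hy.path hlrS.path o2.symm hyN hlN'
  have hpair : ∀ a b : D, ({Δ.rev a, Δ.rev (Δ.rev b)} : Set D) = {b, Δ.rev a} := fun a b => by
    rw [Δ.rev_rev, Set.pair_comm]
  have hTyr : ∀ m, Δ.Joins T p r m → Δ.Off m (Δ.revList y) := fun m hm =>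
    off_revList_right.2 ((hTy m hm).mono (fun _ h => h) (by simp +contextual))
  have hcomm : ∀ {P x}, Δ.Linked S N P {Δ.rev q, Δ.rev (Δ.rev s)} x c →
      Δ.Linked S N P {s, Δ.rev q} x c := fun h => by rwa [hpair] at h
  have hcomm' : ∀ {Q}, Δ.Linked S N {Δ.rev r, Δ.rev (Δ.rev p)} Q (Δ.revList l) c →
      Δ.Linked S N {p, Δ.rev r} Q l c := fun h => by
    rw [hpair] at h
    obtain ⟨α, β, hα, hβ, h⟩ := h
    refine ⟨α, β, hα, hβ, fun u hu v hv huv huN => ?_⟩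
    obtain ⟨⟨a, ha, hua⟩, h2⟩ := h u hu v hv huv huN
    exact ⟨⟨Δ.rev a, by simpa using ha, by rwa [key_rev]⟩, h2⟩
  rcases hA with hA | hA <;> rcases hB with hB | hB
  · refine ⟨c, hc, hcN, ?_⟩
    rcases hD with hD | hD
    · exact hcomm (linked_of_lands hS hlS hyS o1 hB (by rwa [revList_revList]))
    · exact linked_of_lands hS hlS hy hly hA hD
  · rcases hD with hD | hD
    · exact linked_of_minimal hS hTr hTS (isMinimalFor_of_minimal hT) hl hy hly hc hcN
        (fun m hm => (hTy m hm).mono (fun _ h => h) (by simp +contextual)) hA hB hD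
    · exact ⟨c, hc, hcN, linked_of_lands hS hlS hy hly hA hD⟩
  · rcases hD with hD | hD
    · exact ⟨c, hc, hcN, hcomm (linked_of_lands hS hlS hyS o1 hB (by rwa [revList_revList]))⟩
    · have := linked_of_minimal hS hTr hTS (isMinimalFor_of_minimal hT) hl hyS o1 hc hcN hTyr hB
        (by rwa [revList_revList]) hD
      rwa [hpair] at this
  · refine ⟨c, hc, hcN, hcomm' ?_⟩
    rcases hC with hC | hC
    · exact hcomm (linked_of_lands hS hlrS hyS o3 hB (by rwa [revList_revList, revList_revList]))
    · exact linked_of_lands hS hlrS hy o2 hA (by rwa [revList_revList])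

end DartSystem

namespace Multigraph

variable {V E : Type*} {G : Multigraph V E}

section Degree

variable {F H : Set E} {v : V}

theorem deg_singleton [DecidableEq V] {e : E} {a b : V} (he : G.inc e = s(a, b)) (v : V) :
    G.deg {e} v = [a, b].count v := by
  have hab : a ≠ b := fun h => G.no_loops e (by simp [he, h])
  by_cases hv : v ∈ G.inc e
  · have h1 : {f ∈ ({e} : Set E) | v ∈ G.inc f} = {e} := by
      ext f
      exact ⟨And.left, fun hf => ⟨hf, by rwa [Set.mem_singleton_iff.1 hf]⟩⟩
    rw [deg, h1, Set.ncard_singleton]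
    rw [he, Sym2.mem_iff] at hv
    rcases hv with rfl | rfl <;> simp [hab, hab.symm]
  · have h1 : {f ∈ ({e} : Set E) | v ∈ G.inc f} = ∅ := by
      ext f
      simp only [Set.mem_singleton_iff, Set.mem_ofPred_eq, Set.mem_empty_iff_false, iff_false]
      rintro ⟨rfl, hf⟩
      exact hv hf
    rw [deg, h1, Set.ncard_empty]
    rw [he, Sym2.mem_iff] at hv
    exact (List.count_eq_zero.2 (by simpa using hv)).symm

theorem isPM_iff {P : Set E} : G.IsPM P ↔ ∀ v, G.deg P v = 1 := by
  simp only [IsPM, IsPMOn, Set.subset_univ, Set.mem_univ, implies_true, true_and, forall_const]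
  refine forall_congr' fun v => ?_
  rw [deg, Set.ncard_eq_one, ExistsUnique]
  refine exists_congr fun a => ?_
  rw [Set.eq_singleton_iff_unique_mem]
  rfl

/-- A circuit is contained in each edge set which it meets and which is closed, at the vertices
of the circuit, under passing to adjacent edges of the circuit. -/
theorem IsCircuit.subset_of_closed (hF : G.IsCircuit F) {v : V} (hvF : v ∈ G.supp F)
    (hvH : v ∈ G.supp H) (h : ∀ w ∈ G.supp F, w ∈ G.supp H → ∀ e ∈ F, w ∈ G.inc e → e ∈ H) :
    F ⊆ H := by
  have h1 : ∀ w, G.Reach F v w → w ∈ G.supp F ∧ w ∈ G.supp H := by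
    intro w hw
    induction hw with
    | refl => exact ⟨hvF, hvH⟩
    | tail _ hab ih =>
      obtain ⟨e, he, hab⟩ := hab
      have he' := h _ ih.1 ih.2 e he (by simp [hab])
      exact ⟨⟨e, he, by simp [hab]⟩, ⟨e, he', by simp [hab]⟩⟩
  intro e he
  obtain ⟨w, hw⟩ : ∃ w, w ∈ G.inc e := ⟨_, Sym2.out_fst_mem _⟩
  have hwF : w ∈ G.supp F := ⟨e, he, hw⟩
  exact h w hwF (h1 w (hF.2.2 v hvF w hwF)).2 e he hw

variable [Finite E]

theorem deg_mono (h : F ⊆ H) (v : V) : G.deg F v ≤ G.deg H v :=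
  Set.ncard_le_ncard (fun _ he => ⟨h he.1, he.2⟩) (Set.toFinite _)

theorem deg_union (h : Disjoint F H) (v : V) : G.deg (F ∪ H) v = G.deg F v + G.deg H v := by
  rw [deg, deg, deg, ← Set.ncard_union_eq _ (Set.toFinite _) (Set.toFinite _)]
  · congr 1
    ext e
    simp only [Set.mem_ofPred_eq, Set.mem_union]
    tauto
  · exact h.mono (fun _ he => he.1) (fun _ he => he.1)

theorem deg_inter_add_deg_diff (F H : Set E) (v : V) :
    G.deg (F ∩ H) v + G.deg (F \ H) v = G.deg F v := by
  rw [← deg_union (Set.disjoint_sdiff_inter.symm), Set.inter_union_sdiff]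

theorem deg_pos_iff : 0 < G.deg F v ↔ ∃ e ∈ F, v ∈ G.inc e :=
  Set.ncard_pos (Set.toFinite _)

/-- Edges of a larger set at a vertex where the degrees agree belong to the smaller set. -/
theorem mem_of_deg_le (h : F ⊆ H) (hd : G.deg H v ≤ G.deg F v) {e : E} (he : e ∈ H)
    (hv : v ∈ G.inc e) : e ∈ F := by
  have h1 : {e ∈ F | v ∈ G.inc e} = {e ∈ H | v ∈ G.inc e} :=
    Set.eq_of_subset_of_ncard_le (fun _ he => ⟨h he.1, he.2⟩) hd (Set.toFinite _)
  exact (h1.symm ▸ (⟨he, hv⟩ : e ∈ {e ∈ H | v ∈ G.inc e}) : e ∈ {e ∈ F | v ∈ G.inc e}).1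

theorem IsCircuit.subset_of_deg (hF : G.IsCircuit F) {H R : Set E} {v : V} (hFR : F ⊆ R)
    (hHR : H ⊆ R) (hR : ∀ w ∈ G.supp F, w ∈ G.supp H → G.deg R w ≤ G.deg H w)
    (hvF : v ∈ G.supp F) (hvH : v ∈ G.supp H) : F ⊆ H :=
  hF.subset_of_closed hvF hvH fun w hw hw' _ he hwe =>
    mem_of_deg_le hHR (hR w hw hw') (hFR he) hwe

/-- Intersecting circuits of a graph of degree two coincide. -/
theorem IsCircuit.eq_of_mem_supp (hF : G.IsCircuit F) (hH : G.IsCircuit H) {R : Set E}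
    (hR : ∀ w, G.deg R w = 2) (hFR : F ⊆ R) (hHR : H ⊆ R) (hvF : v ∈ G.supp F)
    (hvH : v ∈ G.supp H) : F = H :=
  (hF.subset_of_deg hFR hHR (fun w _ hw => by rw [hR, hH.2.1 w hw]) hvF hvH).antisymm
    (hH.subset_of_deg hHR hFR (fun w _ hw => by rw [hR, hF.2.1 w hw]) hvH hvF)

theorem IsCircuit.subset_of_deg_ne_one (hF : G.IsCircuit F) (hHF : H ⊆ F)
    (hH : H.Nonempty) (hd : ∀ v, G.deg H v ≠ 1) : F ⊆ H := by
  obtain ⟨e, he⟩ := hH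
  have hv : (G.inc e).out.1 ∈ G.inc e := Sym2.out_fst_mem _
  refine hF.subset_of_deg subset_rfl hHF (fun w hw hw' => ?_) ⟨e, hHF he, hv⟩ ⟨e, he, hv⟩
  have h1 := hF.2.1 w hw
  have h2 : 0 < G.deg H w := deg_pos_iff.2 hw'
  have h3 := hd w
  omega

theorem deg_diff_of_mem_supp {M : Set E} (hF : G.IsCircuit F)
    (hMF : ∀ v ∈ G.supp F, ∀ e ∈ M, v ∈ G.inc e → e ∈ F) (hv : v ∈ G.supp F) :
    G.deg M v + G.deg (F \ M) v = 2 := by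
  rw [← hF.2.1 v hv, ← deg_inter_add_deg_diff F M v]
  exact congrArg (· + _) (congrArg Set.ncard (Set.ext fun e =>
    ⟨fun h => ⟨⟨hMF v hv e h.1 h.2, h.1⟩, h.2⟩, fun h => ⟨h.1.2, h.2⟩⟩))

end Degree

variable (G) in
/-- The orientations of the edges in `M`, given by an edge and its first vertex. -/
def Dart (M : Set E) : Type _ := {d : E × V // d.1 ∈ M ∧ d.2 ∈ G.inc d.1}

namespace Dart

variable {M : Set E}

/-- The first vertex. -/
def fst (d : G.Dart M) : V := d.1.2

/-- The underlying edge. -/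
def edge (d : G.Dart M) : E := d.1.1

theorem edge_mem (d : G.Dart M) : d.edge ∈ M := d.2.1

theorem fst_mem (d : G.Dart M) : d.fst ∈ G.inc d.edge := d.2.2

theorem ext {a b : G.Dart M} (h : a.edge = b.edge) (h' : a.fst = b.fst) : a = b :=
  Subtype.ext (Prod.ext h h')

instance [Finite V] [Finite E] : Finite (G.Dart M) := inferInstanceAs (Finite (Subtype _))

/-- The opposite orientation. -/
noncomputable def symm (d : G.Dart M) : G.Dart M :=
  ⟨(d.edge, Sym2.Mem.other d.fst_mem), d.edge_mem, Sym2.other_mem _⟩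

/-- The last vertex. -/
noncomputable def snd (d : G.Dart M) : V := d.symm.fst

@[simp] theorem edge_symm (d : G.Dart M) : d.symm.edge = d.edge := rfl

theorem inc_edge (d : G.Dart M) : G.inc d.edge = s(d.fst, d.snd) := (Sym2.other_spec d.fst_mem).symm

theorem fst_ne_snd (d : G.Dart M) : d.fst ≠ d.snd := fun h =>
  G.no_loops d.edge (by simp [d.inc_edge, h])

theorem fst_symm (d : G.Dart M) : d.symm.fst = d.snd := rfl

theorem snd_symm (d : G.Dart M) : d.symm.snd = d.fst := by
  have h1 := d.symm.inc_edge
  rw [edge_symm, inc_edge, fst_symm, Sym2.eq_iff] at h1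
  rcases h1 with h1 | h1
  · exact absurd h1.1 d.fst_ne_snd
  · exact h1.1.symm

theorem mem_inc {d : G.Dart M} {v : V} : v ∈ G.inc d.edge ↔ v = d.fst ∨ v = d.snd := by
  rw [inc_edge, Sym2.mem_iff]

end Dart

variable (G) in
/-- The darts of an edge set. -/
noncomputable def darts (M : Set E) : DartSystem (G.Dart M) E where
  rev := Dart.symm
  key := Dart.edge
  rev_rev d := Dart.ext rfl (by rw [Dart.fst_symm, Dart.snd_symm])
  rev_ne d h := d.fst_ne_snd (congrArg Dart.fst h).symm
  key_eq a b := by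
    constructor
    · intro h
      have hb := b.fst_mem
      rw [← h, Dart.mem_inc] at hb
      exact hb.imp (Dart.ext h.symm) (Dart.ext h.symm)
    · rintro (rfl | rfl) <;> rfl

/-- An edge in `Y` leads from the end of the first dart to the beginning of the second. -/
def Step {M : Set E} (Y : Set E) (a b : G.Dart M) : Prop := ∃ f ∈ Y, G.inc f = s(a.snd, b.fst)

theorem Step.mono {M Y Z : Set E} (h : Y ⊆ Z) {a b : G.Dart M} (hab : Step Y a b) :
    Step Z a b := by
  obtain ⟨f, hf, hab⟩ := hab
  exact ⟨f, h hf, hab⟩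

theorem reversible_step {M Y : Set E} : (G.darts M).Reversible (Step Y) := by
  rintro a b ⟨f, hf, hab⟩
  refine ⟨f, hf, ?_⟩
  rw [hab, Sym2.eq_swap]
  exact congrArg₂ _ b.snd_symm.symm rfl

/-- The list of the ends of the darts. -/
noncomputable def ends {M : Set E} (l : List (G.Dart M)) : List V := l.flatMap fun d => [d.fst, d.snd]

/-- The set of the underlying edges. -/
def edges {M : Set E} (l : List (G.Dart M)) : Set E := {e | ∃ d ∈ l, d.edge = e}

section Ends

variable {M Y : Set E}

theorem edges_subset {l : List (G.Dart M)} : edges l ⊆ M := by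
  rintro _ ⟨d, _, rfl⟩
  exact d.edge_mem

theorem eq_of_joins_of_snd_eq {Y Z : Set E} {p r r' : G.Dart M} {l l' : List (G.Dart M)}
    (hl : (G.darts M).Joins (Step Y) p r l) (hl' : (G.darts M).Joins (Step Z) p r' l')
    (hr : r.snd = p.fst) (hr' : r'.snd = p.fst) (hd : G.deg M p.fst = 2) : r = r' := by
  have hne : ∀ {Y r l}, (G.darts M).Joins (Step Y) p r l → r.snd = p.fst → r.edge ≠ p.edge := by
    intro Y r l hl hr h
    rw [hl.path.eq_of_key hl.mem_last hl.mem_head h] at hr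
    exact p.fst_ne_snd hr.symm
  have hmem : ∀ {r : G.Dart M}, r.snd = p.fst → r.edge ∈ {e ∈ M | p.fst ∈ G.inc e} :=
    fun hr => ⟨Dart.edge_mem _, Dart.mem_inc.2 (Or.inr hr.symm)⟩
  obtain ⟨a, b, -, hab⟩ := Set.ncard_eq_two.1 hd
  have h1 : p.edge ∈ ({a, b} : Set E) := hab ▸ ⟨p.edge_mem, p.fst_mem⟩
  have h2 : r.edge ∈ ({a, b} : Set E) := hab ▸ hmem hr
  have h3 : r'.edge ∈ ({a, b} : Set E) := hab ▸ hmem hr'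
  have h4 := hne hl hr
  have h5 := hne hl' hr'
  have h6 : r.edge = r'.edge := by
    simp only [Set.mem_insert_iff, Set.mem_singleton_iff] at h1 h2 h3
    grind
  rcases ((G.darts M).key_eq r r').1 h6 with h | h
  · exact h.symm
  · rw [h, ← hr] at hr'
    exact absurd (r.snd_symm.symm.trans hr') r.fst_ne_snd

variable [Finite E] [DecidableEq V]

theorem deg_edges {l : List (G.Dart M)}
    (h : l.Pairwise (fun a b => (G.darts M).key a ≠ (G.darts M).key b)) (v : V) :
    G.deg (edges l) v = (ends l).count v := by
  induction l with
  | nil => simp [deg, edges, ends]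
  | cons d l ih =>
    rw [List.pairwise_cons] at h
    have h1 : edges (d :: l) = {d.edge} ∪ edges l := by
      ext e; simp [edges, eq_comm]
    rw [h1, deg_union, ih h.2, deg_singleton d.inc_edge, ← List.count_append]
    · rfl
    · rw [Set.disjoint_singleton_left]
      rintro ⟨b, hb, hbd⟩
      exact h.1 b hb hbd.symm

/-- The edges in `Y` joining consecutive darts of a chain. -/
theorem exists_steps (l : List (G.Dart M)) : ∀ d r, (d :: l).IsChain (Step Y) →
    (d :: l).getLast? = some r → ∃ J ⊆ Y, ∃ I, ends (d :: l) = d.fst :: (I ++ [r.snd]) ∧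
      (I.Nodup → ∀ v, G.deg J v = I.count v) := by
  induction l with
  | nil =>
    rintro d r - hr
    obtain rfl : d = r := by simpa using hr
    exact ⟨∅, by simp, [], by simp [ends], by simp [deg]⟩
  | cons d' l ih =>
    intro d r hc hr
    rw [List.isChain_cons_cons] at hc
    obtain ⟨⟨f, hf, hff⟩, hc⟩ := hc
    obtain ⟨J, hJ, I, hI, hJI⟩ := ih d' r hc (by simpa using hr)
    refine ⟨{f} ∪ J, Set.union_subset (by simpa using hf) hJ, d.snd :: d'.fst :: I, ?_, ?_⟩
    · rw [ends, List.flatMap_cons, ← ends, hI]; simp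
    · intro hn v
      simp only [List.nodup_cons, List.mem_cons, not_or] at hn
      rw [deg_union, hJI hn.2.2, deg_singleton hff, ← List.count_append]
      · rfl
      · rw [Set.disjoint_singleton_left]
        intro hfJ
        have h1 : 0 < G.deg J d'.fst := deg_pos_iff.2 ⟨f, hfJ, by simp [hff]⟩
        rw [hJI hn.2.2, List.count_pos_iff] at h1
        exact hn.2.1 h1

/-- The edges in `Y` joining consecutive darts of a path meeting each vertex at most once, apart
from its beginning and its end. -/
theorem exists_joins {p r : G.Dart M} {l : List (G.Dart M)}
    (hl : (G.darts M).Joins (Step Y) p r l)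
    (hM : ∀ v, G.deg (edges l) v ≤ [p.fst, r.snd].count v + 1) :
    ∃ J ⊆ Y, ∀ v, G.deg (edges l) v = [p.fst, r.snd].count v + G.deg J v := by
  obtain ⟨l', rfl⟩ : ∃ l', l = p :: l' := by
    have := hl.head
    cases l with
    | nil => simp at this
    | cons a t => exact ⟨t, by simpa using this⟩
  obtain ⟨J, hJ, I, hI, hJI⟩ := exists_steps l' p r hl.path.chain hl.last
  have h1 : ∀ v, G.deg (edges (p :: l')) v = [p.fst, r.snd].count v + I.count v := by
    intro v
    rw [deg_edges hl.path.pairwise, hI]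
    simp only [List.count_cons, List.count_append, List.count_nil]
    omega
  refine ⟨J, hJ, fun v => ?_⟩
  rw [hJI (List.nodup_iff_count_le_one.2 fun v => ?_), h1]
  have h3 := hM v
  have h4 := h1 v
  omega

/-- Switching along a path between the two vertices of excessive degree yields a perfect
matching. -/
theorem exists_isPM {p r : G.Dart M} {l : List (G.Dart M)} {a b : V}
    (hl : (G.darts M).Joins (Step Mᶜ) p r l) (hp : p.fst = a) (hr : r.snd = b)
    (hM : ∀ v, G.deg M v = [a, b].count v + 1) :
    ∃ P, G.IsPM P ∧ M \ edges l ⊆ P := by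
  subst hp hr
  obtain ⟨J, hJ, hJd⟩ := exists_joins hl fun v => (deg_mono edges_subset v).trans (hM v).le
  refine ⟨M \ edges l ∪ J, isPM_iff.2 fun v => ?_, Set.subset_union_left⟩
  rw [deg_union]
  · have h1 := deg_inter_add_deg_diff (G := G) M (edges l) v
    rw [Set.inter_eq_self_of_subset_right edges_subset, hM, hJd] at h1
    omega
  · exact Set.disjoint_left.2 fun e he heJ => hJ heJ he.1

variable {F : Set E}

theorem deg_edges_le {p : G.Dart M} {l : List (G.Dart M)} (hlF : edges l ⊆ F)
    (hM : ∀ v ∈ G.supp F, v ≠ p.fst → G.deg M v = 1) (hp2 : G.deg M p.fst ≤ 2) (v z : V) :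
    G.deg (edges l) v ≤ [p.fst, z].count v + 1 := by
  have h1 := deg_mono (G := G) (edges_subset (l := l)) v
  by_cases hv : v ∈ G.supp F
  · by_cases hvp : v = p.fst
    · subst hvp
      rw [List.count_cons_self]
      omega
    · have := hM v hv hvp
      omega
  · have h2 : ¬ 0 < G.deg (edges l) v := fun h =>
      let ⟨e, he, hve⟩ := deg_pos_iff.1 h
      hv ⟨e, hlF he, hve⟩
    omega

/-- A path in a circuit which cannot be extended. -/
theorem exists_maximal_path [Finite V] (hF : G.IsCircuit F) (p : G.Dart M) (hp : p.edge ∈ F)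
    (hMF : ∀ v ∈ G.supp F, ∀ e ∈ M, v ∈ G.inc e → e ∈ F)
    (hM : ∀ v ∈ G.supp F, v ≠ p.fst → G.deg M v = 1) (hp2 : G.deg M p.fst ≤ 2) :
    ∃ r l, (G.darts M).Joins (Step (F \ M)) p r l ∧ edges l ⊆ F ∧
      ∀ f ∈ F \ M, ∀ w, G.inc f = s(r.snd, w) → w = p.fst := by
  by_contra! h
  have hext : ∀ n : ℕ, ∃ r l, (G.darts M).Joins (Step (F \ M)) p r l ∧ edges l ⊆ F ∧
      n ≤ l.length := by
    intro n
    induction n with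
    | zero => exact ⟨p, [p], ⟨⟨by simp, by simp⟩, rfl, rfl⟩, by simp [edges, hp], by simp⟩
    | succ n ih =>
      obtain ⟨r, l, hl, hlF, hn⟩ := ih
      obtain ⟨f, hf, w, hfw, hwp⟩ := h r l hl hlF
      have hwf : w ∈ G.inc f := by simp [hfw]
      have hrf : r.snd ∈ G.inc f := by simp [hfw]
      have hwF : w ∈ G.supp F := ⟨f, hf.1, hwf⟩
      have hwr : w ≠ r.snd := by rintro rfl; exact G.no_loops f (by simp [hfw])
      have hw1 := hM w hwF hwp
      obtain ⟨e, he, hwe⟩ := deg_pos_iff.1 (hw1 ▸ Nat.one_pos : 0 < G.deg M w)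
      set d : G.Dart M := ⟨(e, w), he, hwe⟩ with hd
      have hel : e ∉ edges l := by
        intro hel
        obtain ⟨J, hJ, hJd⟩ := exists_joins hl fun v => deg_edges_le hlF hM hp2 v r.snd
        have h1 := hJd w
        have h2 : 0 < G.deg (edges l) w := deg_pos_iff.2 ⟨e, hel, hwe⟩
        rw [List.count_eq_zero.2 (by simp [hwr, hwp])] at h1
        have h3 := deg_diff_of_mem_supp hF hMF hwF
        have h4 : f ∈ J := mem_of_deg_le hJ (by omega) hf hwf
        have h5 : 0 < G.deg J r.snd := deg_pos_iff.2 ⟨f, h4, hrf⟩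
        have h6 := hJd r.snd
        have h7 := deg_mono (G := G) (edges_subset (l := l)) r.snd
        by_cases hr : r.snd = p.fst
        · rw [hr] at h5 h6 h7
          simp only [List.count_cons_self] at h6
          omega
        · have h8 := hM r.snd ⟨f, hf.1, hrf⟩ hr
          simp only [List.count_cons, List.count_nil, beq_self_eq_true, if_true] at h6
          omega
      refine ⟨d, l ++ [d], ⟨hl.path.append ⟨by simp, by simp⟩ ?_ ?_, ?_, by simp⟩, ?_, by simpa⟩
      · intro a ha b hb hab
        rw [List.mem_singleton.1 hb] at hab
        exact hel ⟨a, ha, hab⟩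
      · intro a ha b hb
        rw [hl.last, Option.mem_some_iff] at ha
        obtain rfl : d = b := by simpa using hb
        exact ⟨f, hf, by rw [hfw, ha]; rfl⟩
      · rw [List.head?_append, hl.head]; rfl
      · rintro _ ⟨a, ha, rfl⟩
        rcases List.mem_append.1 ha with ha | ha
        · exact hlF ⟨a, ha, rfl⟩
        · rw [List.mem_singleton.1 ha]
          exact hMF w hwF e he hwe
  have := Fintype.ofFinite (G.Dart M)
  obtain ⟨r, l, hl, -, hn⟩ := hext (Fintype.card (G.Dart M) + 1)
  have := hl.path.nodup.length_le_card
  omega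

/-- A circuit in which exactly one vertex is incident with two edges of `M`. -/
theorem IsCircuit.exists_joins [Finite V] (hF : G.IsCircuit F) (p : G.Dart M) (hp : p.edge ∈ F)
    (hMF : ∀ v ∈ G.supp F, ∀ e ∈ M, v ∈ G.inc e → e ∈ F)
    (hM : ∀ v ∈ G.supp F, v ≠ p.fst → G.deg M v = 1) (hp2 : G.deg M p.fst = 2) :
    ∃ r l, (G.darts M).Joins (Step (F \ M)) p r l ∧ r.snd = p.fst ∧ edges l = F ∩ M := by
  obtain ⟨r, l, hl, hlF, hmax⟩ := exists_maximal_path hF p hp hMF hM hp2.le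
  have hpF : p.fst ∈ G.supp F := ⟨_, hp, p.fst_mem⟩
  have hr : r.snd = p.fst := by
    by_contra hr
    have hrF : r.snd ∈ G.supp F :=
      ⟨r.edge, hlF ⟨r, hl.mem_last, rfl⟩, Dart.mem_inc.2 (Or.inr rfl)⟩
    have h1 := deg_diff_of_mem_supp hF hMF hrF
    rw [hM _ hrF hr] at h1
    obtain ⟨f, hf, hrf⟩ := deg_pos_iff.1 (by omega : 0 < G.deg (F \ M) r.snd)
    obtain ⟨w, hw⟩ := Sym2.mem_iff_exists.1 hrf
    have h2 : 0 < G.deg (F \ M) w := deg_pos_iff.2 ⟨f, hf, by simp [hw]⟩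
    rw [hmax f hf w hw] at h2
    have h3 := deg_diff_of_mem_supp hF hMF hpF
    omega
  refine ⟨r, l, hl, hr, (Set.subset_inter hlF edges_subset).antisymm ?_⟩
  obtain ⟨J, hJ, hJd⟩ := Multigraph.exists_joins hl fun v => deg_edges_le hlF hM hp2.le v r.snd
  have hdisj : Disjoint (edges l) J := Set.disjoint_left.2 fun e he heJ => (hJ heJ).2 (edges_subset he)
  have h1 : F ⊆ edges l ∪ J := by
    refine hF.subset_of_deg_ne_one (Set.union_subset hlF (hJ.trans Set.sdiff_subset))
      ⟨p.edge, Or.inl ⟨p, hl.mem_head, rfl⟩⟩ fun v => ?_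
    rw [deg_union hdisj, hJd, hr]
    simp only [List.count_cons, List.count_nil]
    omega
  exact fun e he => (h1 he.1).resolve_right fun h => (hJ h).2 he.2

/-- A circuit each vertex of which is incident with exactly one edge of `M`. -/
theorem IsCircuit.exists_isClosedPath [Finite V] (hF : G.IsCircuit F)
    (hMF : ∀ v ∈ G.supp F, ∀ e ∈ M, v ∈ G.inc e → e ∈ F)
    (hM : ∀ v ∈ G.supp F, G.deg M v = 1) :
    ∃ c, (G.darts M).IsClosedPath (Step (F \ M)) c ∧ edges c = F ∩ M := by
  obtain ⟨v, hv⟩ : (G.supp F).Nonempty :=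
    let ⟨e, he⟩ := hF.1
    ⟨_, e, he, Sym2.out_fst_mem _⟩
  obtain ⟨e, he, hve⟩ := deg_pos_iff.1 (hM v hv ▸ Nat.one_pos : 0 < G.deg M v)
  set p : G.Dart M := ⟨(e, v), he, hve⟩ with hpdef
  have hp : p.edge ∈ F := hMF v hv e he hve
  have hp2 : G.deg M p.fst ≤ 2 := by rw [hM _ ⟨_, hp, p.fst_mem⟩]; omega
  obtain ⟨r, l, hl, hlF, hmax⟩ := exists_maximal_path hF p hp hMF (fun v hv _ => hM v hv) hp2
  have hrF : r.snd ∈ G.supp F :=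
    ⟨r.edge, hlF ⟨r, hl.mem_last, rfl⟩, Dart.mem_inc.2 (Or.inr rfl)⟩
  have h1 := deg_diff_of_mem_supp hF hMF hrF
  rw [hM _ hrF] at h1
  obtain ⟨f, hf, hrf⟩ := deg_pos_iff.1 (by omega : 0 < G.deg (F \ M) r.snd)
  obtain ⟨w, hw⟩ := Sym2.mem_iff_exists.1 hrf
  rw [hmax f hf w hw] at hw
  refine ⟨l, ⟨hl.path, fun a ha b hb => ?_⟩, (Set.subset_inter hlF edges_subset).antisymm ?_⟩
  · rw [hl.last, Option.mem_some_iff] at ha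
    rw [hl.head, Option.mem_some_iff] at hb
    exact ⟨f, hf, by rw [hw, ha, hb]⟩
  obtain ⟨J, hJ, hJd⟩ := Multigraph.exists_joins hl fun v =>
    deg_edges_le hlF (fun v hv _ => hM v hv) hp2 v r.snd
  have hfJ : f ∉ J := by
    intro hfJ
    have h2 : 0 < G.deg J r.snd := deg_pos_iff.2 ⟨f, hfJ, hrf⟩
    have h3 := hJd r.snd
    have h4 := deg_mono (G := G) (edges_subset (l := l)) r.snd
    rw [hM _ hrF] at h4
    simp only [List.count_cons, List.count_nil, beq_self_eq_true, if_true] at h3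
    omega
  have hJf : {f} ∪ J ⊆ F \ M := Set.union_subset (by simpa using hf) hJ
  have hdisj : Disjoint (edges l) ({f} ∪ J) :=
    Set.disjoint_left.2 fun e he heJ => (hJf heJ).2 (edges_subset he)
  have h5 : F ⊆ edges l ∪ ({f} ∪ J) := by
    refine hF.subset_of_deg_ne_one (Set.union_subset hlF (hJf.trans Set.sdiff_subset))
      ⟨p.edge, Or.inl ⟨p, hl.mem_head, rfl⟩⟩ fun v => ?_
    rw [deg_union hdisj, deg_union (by simpa using hfJ), hJd, deg_singleton hw]
    simp only [List.count_cons, List.count_nil]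
    omega
  exact fun e he => (h5 he.1).resolve_right fun h => (hJf h).2 he.2

theorem exists_joins_pair [Finite V] {F' : Set E} {u : V} (hF : G.IsCircuit F)
    (hF' : G.IsCircuit F') (hu : u ∈ G.supp F) (hu' : u ∈ G.supp F')
    (hMF : ∀ v ∈ G.supp F, ∀ e ∈ M, v ∈ G.inc e → e ∈ F)
    (hMF' : ∀ v ∈ G.supp F', ∀ e ∈ M, v ∈ G.inc e → e ∈ F')
    (hM : ∀ v ∈ G.supp F, v ≠ u → G.deg M v = 1) (hM' : ∀ v ∈ G.supp F', v ≠ u → G.deg M v = 1)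
    (hd : G.deg M u = 2) :
    ∃ (p r : G.Dart M) (x c : List (G.Dart M)), p.fst = u ∧ r.snd = u ∧
      (G.darts M).Joins (Step Mᶜ) p r x ∧ (G.darts M).Joins (Step Mᶜ) p r c ∧
      edges x = F ∩ M ∧ edges c = F' ∩ M := by
  obtain ⟨e, he, hue⟩ := deg_pos_iff.1 (hd ▸ Nat.two_pos : 0 < G.deg M u)
  obtain ⟨p, rfl, hp⟩ : ∃ p : G.Dart M, p.fst = u ∧ p.edge = e := ⟨⟨(e, u), he, hue⟩, rfl, rfl⟩
  subst hp
  obtain ⟨r, x, hx, hr, hxF⟩ := hF.exists_joins p (hMF _ hu _ he hue) hMF hM hd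
  obtain ⟨r', c, hc, hr', hcF⟩ := hF'.exists_joins p (hMF' _ hu' _ he hue) hMF' hM' hd
  obtain rfl := eq_of_joins_of_snd_eq hx hc hr hr' hd
  exact ⟨p, r, x, c, rfl, hr, hx.mono fun _ _ => Step.mono fun _ h => h.2,
    hc.mono fun _ _ => Step.mono fun _ h => h.2, hxF, hcF⟩

end Ends

end Multigraph

open Multigraph in
/-- Claim 2 in the proof of Theorem 2. -/
theorem statement_6 {V E : Type*} [Fintype V] [Fintype E] (G : Multigraph V E)
    (hcubic : G.IsCubic) (hbridgeless : G.Bridgeless)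
    (C1 C2 : Set E) (hC1 : G.IsCircuit C1) (hC2 : G.IsCircuit C2)
    (hodd1 : Odd C1.ncard) (hodd2 : Odd C2.ncard)
    (hdisj : G.supp C1 ∩ G.supp C2 = ∅)
    (hspan : G.supp C1 ∪ G.supp C2 = Set.univ)
    (u1 u2 : V) (e12 : E) (hinc : G.inc e12 = s(u1, u2))
    (hu1 : u1 ∈ G.supp C1) (hu2 : u2 ∈ G.supp C2)
    (M3 : Set E) (hM3 : M3 = Set.univ \ (C1 ∪ C2))
    (M2 : Set E) (hM2 : G.IsPM M2) (hM2cap : M2 ∩ M3 = {e12})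
    (M1 : Set E) (hM1 : M1 = (C1 ∪ C2) \ M2)
    (C3 C4 : Set E)
    (hC3 : G.IsCircuit C3) (hC3sub : C3 ⊆ Set.univ \ M2) (hu1C3 : u1 ∈ G.supp C3)
    (hC4 : G.IsCircuit C4) (hC4sub : C4 ⊆ Set.univ \ M2) (hu2C4 : u2 ∈ G.supp C4)
    (hne : C3 ≠ C4) (hC3C2 : C3 ∩ C2 = ∅) (hC1C4 : C1 ∩ C4 = ∅)
    (C5 : Set E) (hC5 : G.IsCircuit C5) (hC5sub : C5 ⊆ Set.univ \ M2)
    (hC5a : (C5 ∩ C1).Nonempty) (hC5b : (C5 ∩ C2).Nonempty)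
    -- `Q` is the inclusionwise maximal path containing `u1` in `C1` with
    -- `E(Q) ∩ E(C5) = ∅`
    (Q : Set E) (hQsub : Q ⊆ C1) (hQC5 : Q ∩ C5 = ∅)
    (hQconn : ∀ w ∈ G.supp Q, G.Reach Q u1 w)
    (hQmax : ∀ Q' : Set E, Q' ⊆ C1 → Q' ∩ C5 = ∅ →
      (∀ w ∈ G.supp Q', G.Reach Q' u1 w) → Q ⊆ Q' → Q' = Q)
    -- the two circuits `C` and `C'`
    (C C' : Set E) (hCcirc : G.IsCircuit C) (hC'circ : G.IsCircuit C')
    -- (1)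
    (hcond1 : u1 ∈ G.supp C ∧ u1 ∈ G.supp C')
    -- (2)
    (hcond2a : (C ∩ C2).Nonempty) (hcond2b : C ∩ C2 ⊆ C5 ∩ C2)
    (hcond2c : C' ∩ C2 ⊆ C5 ∩ C2) (hcond2d : C ∩ C' ∩ C2 = ∅)
    -- (3) the edges of `Q` lie in the component of `C` minus `E(C) ∩ E(C2)`
    -- containing `u1`, and each other component `Qi` satisfies that
    -- `M2 ∩ E(Qi)` is a perfect matching of `Qi − (V(Qi) ∩ V(C2))`
    (hcond3a : Q ⊆ {f ∈ C \ (C ∩ C2) | ∀ w ∈ G.inc f, G.Reach (C \ (C ∩ C2)) u1 w})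
    (hcond3b : ∀ v ∈ G.supp C, ¬ G.Reach (C \ (C ∩ C2)) u1 v →
      G.IsPMOn
        ({w | G.Reach (C \ (C ∩ C2)) v w} \ G.supp C2)
        {f ∈ C \ (C ∩ C2) | ∀ w ∈ G.inc f, G.Reach (C \ (C ∩ C2)) v w}
        (M2 ∩ {f ∈ C \ (C ∩ C2) | ∀ w ∈ G.inc f, G.Reach (C \ (C ∩ C2)) v w}))
    -- (4)
    (N2 N3 : Set E)
    (hN2 : G.IsPMOn (G.supp C1 \ G.supp C) Set.univ N2)
    (hN3 : G.IsPMOn (G.supp C1 \ G.supp C) Set.univ N3)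
    (hcond4 : C1 \ (C ∪ N2 ∪ N3) ⊆ (M1 ∩ C1) \ C')
    -- (5)
    (hcond5a : G.IsPMOn (G.supp C1 \ G.supp C') C1 ((M1 ∩ C1) \ C'))
    (hcond5b : G.IsPMOn (G.supp C' \ {u1}) C' (C' \ M1)) :
    ∃ P1 P2 P3 P4 P5 : Set E, G.IsPM P1 ∧ G.IsPM P2 ∧ G.IsPM P3 ∧
      G.IsPM P4 ∧ G.IsPM P5 ∧ ∀ e : E, e ∈ P1 ∪ P2 ∪ P3 ∪ P4 ∪ P5 := by
  classical
  have hC12 : Disjoint C1 C2 := Set.disjoint_left.2 fun e h1 h2 =>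
    Set.eq_empty_iff_forall_notMem.1 hdisj (G.inc e).out.1
      ⟨⟨e, h1, Sym2.out_fst_mem _⟩, ⟨e, h2, Sym2.out_fst_mem _⟩⟩
  have hnot : ∀ v, v ∈ G.supp C1 → v ∉ G.supp C2 := fun v h1 h2 =>
    Set.eq_empty_iff_forall_notMem.1 hdisj v ⟨h1, h2⟩
  have hu12 : u1 ≠ u2 := fun h => hnot u1 hu1 (h ▸ hu2)
  have hB : ∀ v, G.deg (C1 ∪ C2) v = 2 := by
    intro v
    rw [deg_union hC12]
    have hv : v ∈ G.supp C1 ∪ G.supp C2 := hspan ▸ Set.mem_univ v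
    rcases hv with hv | hv
    · have h1 : ¬ 0 < G.deg C2 v := fun h => hnot v hv (deg_pos_iff.1 h)
      have h2 := hC1.2.1 v hv
      omega
    · have h1 : ¬ 0 < G.deg C1 v := fun h => hnot v (deg_pos_iff.1 h) hv
      have h2 := hC2.2.1 v hv
      omega
  have hM3d : ∀ v, G.deg M3 v = 1 := by
    intro v
    have h1 := deg_inter_add_deg_diff (G := G) Set.univ (C1 ∪ C2) v
    rw [Set.univ_inter, hB, hcubic v, ← hM3] at h1
    omega
  have hM2d := isPM_iff.1 hM2
  have hRd : ∀ v, G.deg (Set.univ \ M2) v = 2 := by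
    intro v
    have h1 := deg_inter_add_deg_diff (G := G) Set.univ M2 v
    rw [Set.univ_inter, hM2d, hcubic v] at h1
    omega
  have hM1d : ∀ v, G.deg M1 v = [u1, u2].count v + 1 := by
    intro v
    have h1 := deg_inter_add_deg_diff (G := G) M2 M3 v
    have h2 := deg_inter_add_deg_diff (G := G) (C1 ∪ C2) M2 v
    have h3 : M2 \ M3 = (C1 ∪ C2) ∩ M2 := by
      rw [hM3, Set.sdiff_sdiff_right, Set.sdiff_univ, Set.empty_union, Set.inter_comm]
    rw [hM2cap, deg_singleton hinc, hM2d, h3] at h1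
    rw [hB, ← hM1] at h2
    omega
  have hM1u1 : G.deg M1 u1 = 2 := by rw [hM1d]; simp [hu12.symm]
  have hM1u2 : G.deg M1 u2 = 2 := by rw [hM1d]; simp [hu12]
  have hM1v : ∀ v, v ≠ u1 → v ≠ u2 → G.deg M1 v = 1 := fun v h1 h2 => by
    rw [hM1d, List.count_eq_zero.2 (by simp [h1, h2])]
  have hM1R : M1 ⊆ Set.univ \ M2 := fun e he => ⟨trivial, (hM1 ▸ he).2⟩
  have hM1B : M1 ⊆ C1 ∪ C2 := fun e he => (hM1 ▸ he).1
  have he12 : e12 ∉ M1 := fun h => by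
    have h1 : e12 ∈ M2 ∩ M3 := hM2cap ▸ rfl
    exact (hM1R h).2 h1.1
  have hcl1 : ∀ v ∈ G.supp C1, ∀ e ∈ M1, v ∈ G.inc e → e ∈ C1 := fun v hv e he hve =>
    (hM1B he).resolve_right fun h => hnot v hv ⟨e, h, hve⟩
  have hcl2 : ∀ v ∈ G.supp C2, ∀ e ∈ M1, v ∈ G.inc e → e ∈ C2 := fun v hv e he hve =>
    (hM1B he).resolve_left fun h => hnot v ⟨e, h, hve⟩ hv
  have hcl : ∀ F, G.IsCircuit F → F ⊆ Set.univ \ M2 →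
      ∀ v ∈ G.supp F, ∀ e ∈ M1, v ∈ G.inc e → e ∈ F := fun F hF hFR v hv e he hve =>
    mem_of_deg_le hFR (by rw [hRd, hF.2.1 v hv]) (hM1R he) hve
  have hu2C3 : u2 ∉ G.supp C3 := fun h =>
    hne (hC3.eq_of_mem_supp hC4 hRd hC3sub hC4sub h hu2C4)
  have hu1C4 : u1 ∉ G.supp C4 := fun h =>
    hne (hC3.eq_of_mem_supp hC4 hRd hC3sub hC4sub hu1C3 h)
  have h35 : ∀ v ∈ G.supp C3, v ∉ G.supp C5 := by
    intro v h3 h5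
    obtain ⟨e, he5, he2⟩ := hC5b
    rw [← hC3.eq_of_mem_supp hC5 hRd hC3sub hC5sub h3 h5] at he5
    exact Set.eq_empty_iff_forall_notMem.1 hC3C2 e ⟨he5, he2⟩
  have h45 : ∀ v ∈ G.supp C4, v ∉ G.supp C5 := by
    intro v h4 h5
    obtain ⟨e, he5, he1⟩ := hC5a
    rw [← hC4.eq_of_mem_supp hC5 hRd hC4sub hC5sub h4 h5] at he5
    exact Set.eq_empty_iff_forall_notMem.1 hC1C4 e ⟨he1, he5⟩
  obtain ⟨p, r, x, c₃, hp, hr, hx, hc₃, hxe, hc₃e⟩ := exists_joins_pair hC1 hC3 hu1 hu1C3 hcl1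
    (hcl C3 hC3 hC3sub) (fun v hv h => hM1v v h fun h' => hnot v hv (h' ▸ hu2))
    (fun v hv h => hM1v v h fun h' => hu2C3 (h' ▸ hv)) hM1u1
  obtain ⟨q, s, y, c₄, hq, hs, hy, hc₄, hye, hc₄e⟩ := exists_joins_pair hC2 hC4 hu2 hu2C4 hcl2
    (hcl C4 hC4 hC4sub) (fun v hv h => hM1v v (fun h' => hnot v (h' ▸ hu1) hv) h)
    (fun v hv h => hM1v v (fun h' => hu1C4 (h' ▸ hv)) h) hM1u2
  obtain ⟨c₅, hc₅, hc₅e⟩ := hC5.exists_isClosedPath (hcl C5 hC5 hC5sub) fun v hv =>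
    hM1v v (fun h => h35 u1 hu1C3 (h ▸ hv)) (fun h => h45 u2 hu2C4 (h ▸ hv))
  have hc₅' := hc₅.mono fun _ _ => Step.mono (Z := M1ᶜ) fun _ h => h.2
  have hout : ∀ e : E, (G.inc e).out.1 ∈ G.inc e := fun e => Sym2.out_fst_mem _
  have hL : ∀ d ∈ x ++ c₃, d.edge ∈ C1 := by
    intro d hd
    rcases List.mem_append.1 hd with hd | hd
    · exact (hxe ▸ (⟨d, hd, rfl⟩ : d.edge ∈ edges x) : d.edge ∈ C1 ∩ M1).1
    · have h1 : d.edge ∈ C3 ∩ M1 := hc₃e ▸ ⟨d, hd, rfl⟩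
      exact (hM1B h1.2).resolve_right fun h =>
        Set.eq_empty_iff_forall_notMem.1 hC3C2 _ ⟨h1.1, h⟩
  have hR : ∀ d ∈ y ++ c₄, d.edge ∈ C2 := by
    intro d hd
    rcases List.mem_append.1 hd with hd | hd
    · exact (hye ▸ (⟨d, hd, rfl⟩ : d.edge ∈ edges y) : d.edge ∈ C2 ∩ M1).1
    · have h1 : d.edge ∈ C4 ∩ M1 := hc₄e ▸ ⟨d, hd, rfl⟩
      exact (hM1B h1.2).resolve_left fun h =>
        Set.eq_empty_iff_forall_notMem.1 hC1C4 _ ⟨h, h1.1⟩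
  have hoff : (G.darts M1).Off (x ++ c₃) (y ++ c₄) := fun a ha b hb hab =>
    Set.disjoint_left.1 hC12 (hL a ha) ((congrArg (· ∈ C2) hab).mpr (hR b hb))
  have hxN : ∃ v ∈ x, (G.darts M1).key v ∈ edges c₅ := by
    obtain ⟨e, he5, he1⟩ := hC5a
    have heM : e ∈ M1 := hM1 ▸ ⟨Or.inl he1, (hC5sub he5).2⟩
    obtain ⟨d, hd, rfl⟩ : e ∈ edges x := hxe ▸ ⟨he1, heM⟩
    exact ⟨d, hd, hc₅e ▸ ⟨he5, heM⟩⟩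
  have hyN : ∃ v ∈ y, (G.darts M1).key v ∈ edges c₅ := by
    obtain ⟨e, he5, he2⟩ := hC5b
    have heM : e ∈ M1 := hM1 ▸ ⟨Or.inr he2, (hC5sub he5).2⟩
    obtain ⟨d, hd, rfl⟩ : e ∈ edges y := hye ▸ ⟨he2, heM⟩
    exact ⟨d, hd, hc₅e ▸ ⟨he5, heM⟩⟩
  have hc₃N : ∀ v ∈ c₃, (G.darts M1).key v ∉ edges c₅ := fun d hd h => by
    have h1 : d.edge ∈ C3 ∩ M1 := hc₃e ▸ ⟨d, hd, rfl⟩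
    have h2 : d.edge ∈ C5 ∩ M1 := hc₅e ▸ h
    exact h35 _ ⟨_, h1.1, hout _⟩ ⟨_, h2.1, hout _⟩
  have hc₄N : ∀ v ∈ c₄, (G.darts M1).key v ∉ edges c₅ := fun d hd h => by
    have h1 : d.edge ∈ C4 ∩ M1 := hc₄e ▸ ⟨d, hd, rfl⟩
    have h2 : d.edge ∈ C5 ∩ M1 := hc₅e ▸ h
    exact h45 _ ⟨_, h1.1, hout _⟩ ⟨_, h2.1, hout _⟩
  obtain ⟨c, α, β, hc, hcL, ⟨a, ha, z, hz, hα⟩, ⟨b, hb, w, hw, hβ⟩, hαβ⟩ :=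
    DartSystem.exists_linked reversible_step hx hc₃ hy hc₅' (fun _ => Iff.rfl) hxN hyN hc₃N hc₄N hoff
  have hstart : ∀ d ∈ ({p, (G.darts M1).rev r} : Set (G.Dart M1)), d.fst = u1 := by
    rintro d (rfl | rfl)
    exacts [hp, hr]
  have hend : ∀ d ∈ ({s, (G.darts M1).rev q} : Set (G.Dart M1)), d.snd = u2 := by
    rintro d (rfl | rfl)
    exacts [hs, q.snd_symm.trans hq]
  have hcc₄ : (G.darts M1).Off c c₄ := fun d hd d' hd' hdd' => by
    obtain ⟨u, hu, hdu⟩ := hcL d hd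
    exact hoff u hu d' (by simp [hd']) (hdu.symm.trans hdd')
  obtain ⟨P3, hP3, hP3e⟩ := exists_isPM
    (hc.append hc₄ hcc₄ ⟨e12, he12, by rw [hr, hq, hinc]⟩) hp hs hM1d
  obtain ⟨P4, hP4, hP4e⟩ := exists_isPM hα (hstart a ha) (hend z hz) hM1d
  obtain ⟨P5, hP5, hP5e⟩ := exists_isPM hβ (hstart b hb) (hend w hw) hM1d
  refine ⟨M2, M3, P3, P4, P5, hM2, isPM_iff.2 hM3d, hP3, hP4, hP5, fun e => ?_⟩
  by_contra he
  simp only [Set.mem_union, not_or] at he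
  obtain ⟨⟨⟨⟨he2, he3⟩, heP3⟩, heP4⟩, heP5⟩ := he
  have heM : e ∈ M1 := by
    rw [hM1]
    rw [hM3] at he3
    exact ⟨by_contra fun h => he3 ⟨trivial, h⟩, he2⟩
  obtain ⟨d, hd, hde⟩ : e ∈ edges (c ++ c₄) := by_contra fun h => heP3 (hP3e ⟨heM, h⟩)
  obtain ⟨u, hu, hue⟩ : e ∈ edges α := by_contra fun h => heP4 (hP4e ⟨heM, h⟩)
  obtain ⟨v, hv, hve⟩ : e ∈ edges β := by_contra fun h => heP5 (hP5e ⟨heM, h⟩)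
  exact hαβ u hu v hv (hue.trans hve.symm) d hd (hue.trans hde.symm)
end

section
/- Let G be a cubic graph with a vertex v such that G − v has a Hamiltonian circuit C. Choose a vertex u on C with uv ∈ E(G), let N1 be the perfect matching of C − u, and consider the subgraph of G induced by the edge set E(G) \ (N1 ∪ {uv}). If the circuit of this subgraph containing u equals the circuit of this subgraph containing v, then G is 3-edge-colorable, i.e., G has three pairwise edge-disjoint perfect matchings. -/
namespace Multigraph

variable {V E : Type*}

open scoped Classical in
/-- A walk from `a` to `b` within `F` yields a `ZMod 2`-valued edge function supported on `F`
whose boundary is the sum of the indicators of `a` and `b`. -/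
theorem Reach.exists_boundary [Fintype E] {G : Multigraph V E} {F : Set E} {a b : V}
    (h : G.Reach F a b) :
    ∃ x : E → ZMod 2, (∀ e ∉ F, x e = 0) ∧
      ∀ w, ∑ e with w ∈ G.inc e, x e = (if w = a then 1 else 0) + (if w = b then 1 else 0) := by
  induction h with
  | refl => exact ⟨0, by simp, fun w => by split_ifs <;> simp; decide⟩
  | @tail b c _ hbc ih =>
    obtain ⟨x, hx, hsum⟩ := ih
    obtain ⟨e, he, hbc⟩ := hbc
    have hne : b ≠ c := fun h => G.no_loops e (by rw [hbc]; simpa using h)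
    refine ⟨x + Pi.single e 1, fun f hf => ?_, fun w => ?_⟩
    · have : f ≠ e := fun h => hf (h ▸ he)
      simp [hx f hf, this]
    · have h1 : ∑ f with w ∈ G.inc f, (Pi.single e 1 : E → ZMod 2) f =
          (if w = b then 1 else 0) + (if w = c then 1 else 0) := by
        rw [Finset.sum_pi_single']
        simp only [Finset.mem_filter, Finset.mem_univ, true_and, hbc, Sym2.mem_iff]
        by_cases hb : w = b <;> by_cases hc : w = c <;> simp_all
      simp only [Pi.add_apply, Finset.sum_add_distrib, hsum, h1]
      split_ifs <;> decide

theorem exists_eq_insert_pair {S : Set E} (hS : S.ncard = 3) {a : E} (ha : a ∈ S) :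
    ∃ b c, a ≠ b ∧ a ≠ c ∧ b ≠ c ∧ S = {a, b, c} := by
  have h2 : (S \ {a}).ncard = 2 := by rw [Set.ncard_sdiff_singleton_of_mem ha, hS]
  obtain ⟨b, c, hbc, h⟩ := Set.ncard_eq_two.mp h2
  have hb : b ∈ S \ {a} := by simp [h]
  have hc : c ∈ S \ {a} := by simp [h]
  refine ⟨b, c, fun h => hb.2 h.symm, fun h => hc.2 h.symm, hbc, ?_⟩
  rw [← h, Set.insert_sdiff_singleton, Set.insert_eq_of_mem ha]

/-- An edge set `M` together with a two-valued function on its complement gives three disjoint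
perfect matchings if they tell apart the three edges at each vertex. -/
theorem exists_three_isPM {G : Multigraph V E} (M : Set E) (y : E → ZMod 2)
    (h : ∀ w, ∃ a b c, (∀ e, w ∈ G.inc e ↔ e = a ∨ e = b ∨ e = c) ∧
      a ∈ M ∧ b ∉ M ∧ c ∉ M ∧ y b ≠ y c) :
    ∃ M1 M2 M3 : Set E, G.IsPM M1 ∧ G.IsPM M2 ∧ G.IsPM M3 ∧
      M1 ∩ M2 = ∅ ∧ M1 ∩ M3 = ∅ ∧ M2 ∩ M3 = ∅ := by
  have hy (i : ZMod 2) : G.IsPM {e | e ∉ M ∧ y e = i} := by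
    refine ⟨Set.subset_univ _, fun _ _ _ _ => trivial, fun w _ => ?_⟩
    obtain ⟨a, b, c, hw, ha, hb, hc, hbc⟩ := h w
    have hi : y b = i ∧ y c ≠ i ∨ y c = i ∧ y b ≠ i := by
      generalize y b = p at *
      generalize y c = q at *
      clear hw
      revert p q i
      decide
    rcases hi with hi | hi
    · refine ⟨b, ⟨⟨hb, hi.1⟩, (hw b).2 (by simp)⟩, ?_⟩
      rintro e ⟨⟨he, hei⟩, hwe⟩
      rcases (hw e).1 hwe with rfl | rfl | rfl
      exacts [absurd ha he, rfl, absurd hei hi.2]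
    · refine ⟨c, ⟨⟨hc, hi.1⟩, (hw c).2 (by simp)⟩, ?_⟩
      rintro e ⟨⟨he, hei⟩, hwe⟩
      rcases (hw e).1 hwe with rfl | rfl | rfl
      exacts [absurd ha he, absurd hei hi.2, rfl]
  refine ⟨M, {e | e ∉ M ∧ y e = 0}, {e | e ∉ M ∧ y e = 1}, ?_, hy 0, hy 1, ?_, ?_, ?_⟩
  · refine ⟨Set.subset_univ _, fun _ _ _ _ => trivial, fun w _ => ?_⟩
    obtain ⟨a, b, c, hw, ha, hb, hc, -⟩ := h w
    refine ⟨a, ⟨ha, (hw a).2 (by simp)⟩, ?_⟩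
    rintro e ⟨he, hwe⟩
    rcases (hw e).1 hwe with rfl | rfl | rfl
    exacts [rfl, absurd he hb, absurd he hc]
  · ext e; simp +contextual
  · ext e; simp +contextual
  · ext e; simp +contextual

end Multigraph

open Multigraph in
/-- From the proof of Theorem 1: if the two circuits coincide, `G` is
3-edge-colorable. -/
theorem statement_7 {V E : Type*} [Fintype V] [Fintype E] (G : Multigraph V E)
    (hcubic : G.IsCubic) (v u : V) (C : Set E)
    (hC : G.IsCircuit C) (hsupp : G.supp C = Set.univ \ {v})
    (hu : u ∈ G.supp C) (euv : E) (hinc : G.inc euv = s(u, v))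
    (N1 : Set E) (hN1 : G.IsPMOn (G.supp C \ {u}) C N1)
    (Cu Cv : Set E)
    (hCu : G.IsCircuit Cu) (hCusub : Cu ⊆ Set.univ \ (N1 ∪ {euv}))
    (huCu : u ∈ G.supp Cu)
    (hCv : G.IsCircuit Cv) (hCvsub : Cv ⊆ Set.univ \ (N1 ∪ {euv}))
    (hvCv : v ∈ G.supp Cv)
    (heq : Cu = Cv) :
    ∃ M1 M2 M3 : Set E, G.IsPM M1 ∧ G.IsPM M2 ∧ G.IsPM M3 ∧
      M1 ∩ M2 = ∅ ∧ M1 ∩ M3 = ∅ ∧ M2 ∩ M3 = ∅ := by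
  classical
  subst heq
  obtain ⟨x, hx, hsum⟩ := (hCu.2.2 u huCu v hvCv).exists_boundary
  have hxM (e) (he : e ∈ N1 ∪ {euv}) : x e = 0 := hx e fun h => (hCusub h).2 he
  have huv : u ≠ v := fun h => G.no_loops euv (by rw [hinc]; simpa using h)
  have hvC (e) (he : v ∈ G.inc e) : e ∉ C := fun h => by
    have : v ∈ G.supp C := ⟨e, h, he⟩
    simp [hsupp] at this
  have hvu : v ∈ G.inc euv := by simp [hinc]
  have huu : u ∈ G.inc euv := by simp [hinc]
  obtain ⟨hN1C, hN1S, hN1⟩ := hN1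
  have huN (e) (he : u ∈ G.inc e) : e ∉ N1 := fun h => (hN1S e h u he).2 rfl
  refine exists_three_isPM (N1 ∪ {euv}) (fun e => x e + if e ∈ C then 1 else 0) fun w => ?_
  have key : ∃ a ∈ N1 ∪ {euv}, w ∈ G.inc a ∧ ∀ e ∈ N1 ∪ {euv}, w ∈ G.inc e → e = a := by
    by_cases hw : w = u ∨ w = v
    · refine ⟨euv, by simp, by simp [hinc, hw], ?_⟩
      rintro e (he | he) hwe
      · rcases hw with rfl | rfl
        exacts [absurd he (huN e hwe), absurd (hN1C he) (hvC e hwe)]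
      · exact he
    · obtain ⟨a, ⟨ha, hwa⟩, hun⟩ := hN1 w (by simpa [hsupp, and_comm] using hw)
      refine ⟨a, Or.inl ha, hwa, ?_⟩
      rintro e (he | rfl) hwe
      · exact hun e ⟨he, hwe⟩
      · exact absurd (by simpa [hinc] using hwe) hw
  obtain ⟨a, ha, hwa, hun⟩ := key
  obtain ⟨b, c, hab, hac, hbc, hS⟩ := exists_eq_insert_pair (hcubic w) (a := a) ⟨trivial, hwa⟩
  have hinc' (e) : w ∈ G.inc e ↔ e = a ∨ e = b ∨ e = c := by
    simpa using Set.ext_iff.mp hS e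
  have hwb := (hinc' b).2 (by simp)
  have hwc := (hinc' c).2 (by simp)
  refine ⟨a, b, c, hinc', ha, fun h => hab (hun b h hwb).symm, fun h => hac (hun c h hwc).symm, ?_⟩
  have hs : x b + x c = (if w = u then 1 else 0) + (if w = v then 1 else 0) := by
    rw [← hsum w, show Finset.univ.filter (fun e => w ∈ G.inc e) = {a, b, c} by ext e; simp [hinc'],
      Finset.sum_insert (by simp [hab, hac]), Finset.sum_pair hbc, hxM a ha, zero_add]
  have hpar : ∀ p q : ZMod 2, (p + q = 0 → p + 1 ≠ q + 0 ∧ p + 0 ≠ q + 1) ∧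
      (p + q = 1 → p + 1 ≠ q + 1 ∧ p + 0 ≠ q + 0) := by decide
  by_cases hwv : w = v
  · subst hwv
    rw [if_neg huv.symm, if_pos rfl, zero_add] at hs
    simpa [hvC b hwb, hvC c hwc] using ((hpar _ _).2 hs).2
  obtain ⟨p, q, hpq, hCw⟩ : ∃ p q, p ≠ q ∧ ∀ e, (e ∈ C ∧ w ∈ G.inc e) ↔ e = p ∨ e = q := by
    obtain ⟨p, q, hpq, h⟩ := Set.ncard_eq_two.mp (hC.2.1 w (by simp [hsupp, hwv]))
    exact ⟨p, q, hpq, fun e => by simpa using Set.ext_iff.mp h e⟩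
  have hp := (hCw p).2 (.inl rfl)
  have hq := (hCw q).2 (.inr rfl)
  have hp' := (hinc' p).1 hp.2
  have hq' := (hinc' q).1 hq.2
  by_cases hwu : w = u
  · subst hwu
    rw [if_neg huv, if_pos rfl, add_zero] at hs
    have haC : a ∉ C := by
      rw [← hun euv (by simp) huu]
      exact hvC euv hvu
    have hbC : b ∈ C := by grind
    have hcC : c ∈ C := by grind
    simpa [hbC, hcC] using ((hpar _ _).2 hs).1
  · rw [if_neg hwu, if_neg hwv, add_zero] at hs
    have haC : a ∈ C := by
      rcases ha with ha | rfl
      · exact hN1C ha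
      · simp [hinc, hwu, hwv] at hwa
    have hbcC : b ∈ C ∧ c ∉ C ∨ b ∉ C ∧ c ∈ C := by grind
    rcases hbcC with h | h
    · simpa [h.1, h.2] using ((hpar _ _).1 hs).1
    · simpa [h.1, h.2] using ((hpar _ _).1 hs).2
end
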